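/- arXiv:2404.02021 — 3 statements merged into one kernel-verified Lean document; each statement's English description precedes it below -/
import Mathlib

section
/- For every integer n ≥ 5, the tight cycle C_n^(3) satisfies m_pair(C_n^(3)) = 1/2 if 3 does not divide n, and m_pair(C_n^(3)) = 1/3 if 3 divides n. -/
/-- A 3-uniform hypergraph on a finite subset of `ℕ`. -/
structure ThreeGraph where
  verts : Finset ℕ
  edges : Finset (Finset ℕ)
  card_eq : ∀ e ∈ edges, e.card = 3
  subset_verts : ∀ e ∈ edges, e ⊆ verts

/-- `χ` (on 3-element subsets of `{0, …, N-1}`) contains a copy of `H` in color `c`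
(`true` = red, `false` = blue). -/
def hasMonoCopy (N : ℕ) (χ : Finset ℕ → Bool) (H : ThreeGraph) (c : Bool) : Prop :=
  ∃ φ : ℕ → ℕ, Set.InjOn φ ↑H.verts ∧ (∀ v ∈ H.verts, φ v < N) ∧
    ∀ e ∈ H.edges, χ (e.image φ) = c

/-- The Ramsey number `r(G, H)`: the least `N` such that every red/blue coloring of the
triples of an `N`-element set contains a red copy of `G` or a blue copy of `H`. -/
noncomputable def ramsey (G H : ThreeGraph) : ℕ :=
  sInf {N : ℕ | ∀ χ : Finset ℕ → Bool,
    hasMonoCopy N χ G true ∨ hasMonoCopy N χ H false}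

/-- The complete tripartite 3-graph `K_{a,b,c}^{(3)}`. -/
def tripartite (a b c : ℕ) : ThreeGraph where
  verts := Finset.range (a + b + c)
  edges := ((Finset.range (a + b + c)).powersetCard 3).filter (fun e =>
    (e.filter (fun x => x < a)).card = 1 ∧
    (e.filter (fun x => a ≤ x ∧ x < a + b)).card = 1 ∧
    (e.filter (fun x => a + b ≤ x)).card = 1)
  card_eq := fun e he => (Finset.mem_powersetCard.mp (Finset.mem_filter.mp he).1).2
  subset_verts := fun e he => (Finset.mem_powersetCard.mp (Finset.mem_filter.mp he).1).1

/-- The complete 3-graph `K_n^{(3)}`. -/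
def completeTG (n : ℕ) : ThreeGraph where
  verts := Finset.range n
  edges := (Finset.range n).powersetCard 3
  card_eq := fun e he => (Finset.mem_powersetCard.mp he).2
  subset_verts := fun e he => (Finset.mem_powersetCard.mp he).1

/-- The shadow of a set of 3-edges: all 2-element subsets of its edges. -/
def shadowOf (E : Finset (Finset ℕ)) : Finset (Finset ℕ) :=
  E.biUnion (fun e => e.powersetCard 2)

/-- An oriented 3-graph (given by its edge set of ordered triples): it contains at most one of
the six coordinate permutations of any ordered triple and no triple with a repeated
coordinate. -/
def Oriented (E : Set (ℕ × ℕ × ℕ)) : Prop :=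
  ∀ a b c : ℕ, (a, b, c) ∈ E →
    (a ≠ b ∧ b ≠ c ∧ a ≠ c) ∧
    (a, c, b) ∉ E ∧ (b, a, c) ∉ E ∧ (b, c, a) ∉ E ∧ (c, a, b) ∉ E ∧ (c, b, a) ∉ E

/-- `f` is a pair homomorphism from `H`, ordered by the (injective on `V(H)`) function `ord`,
to the oriented 3-graph with edge set `E`. -/
def IsPairHom (H : ThreeGraph) (ord : ℕ → ℕ) (E : Set (ℕ × ℕ × ℕ))
    (f : Finset ℕ → ℕ) : Prop :=
  Set.InjOn ord ↑H.verts ∧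
  ∀ e ∈ H.edges, ∀ u v w : ℕ, e = {u, v, w} → ord u < ord v → ord v < ord w →
    (f {u, v} ≠ f {v, w} ∧ f {v, w} ≠ f {u, w} ∧ f {u, v} ≠ f {u, w}) ∧
    (f {u, v}, f {v, w}, f {u, w}) ∈ E

/-- `v(f(H'))` for the subhypergraph with edge set `E'`: the number of vertices of the image,
i.e. the size of the image of the shadow of `E'` under `f`. -/
def imageVerts (f : Finset ℕ → ℕ) (E' : Finset (Finset ℕ)) : ℕ :=
  ((shadowOf E').image f).card

/-- `e(f(H'))` for the subhypergraph with edge set `E'`: the number of distinct image triples. -/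
noncomputable def imageEdges (ord : ℕ → ℕ) (f : Finset ℕ → ℕ)
    (E' : Finset (Finset ℕ)) : ℕ :=
  Set.ncard {p : ℕ × ℕ × ℕ | ∃ e ∈ E', ∃ u v w : ℕ,
    e = ({u, v, w} : Finset ℕ) ∧ ord u < ord v ∧ ord v < ord w ∧
    p = (f {u, v}, f {v, w}, f {u, w})}

/-- The pair density `m_pair(H)`: the minimum, over all orderings of `V(H)` and all pair
homomorphisms `f` from `H` to any oriented 3-graph, of the maximum over all nonempty
subhypergraphs `H' ⊆ H` of `e(f(H')) / v(f(H'))`. -/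
noncomputable def mpair (H : ThreeGraph) : ℝ :=
  sInf {q : ℝ | ∃ (ord : ℕ → ℕ) (E : Set (ℕ × ℕ × ℕ)) (f : Finset ℕ → ℕ),
    Oriented E ∧ IsPairHom H ord E f ∧
    q = sSup {r : ℝ | ∃ E' : Finset (Finset ℕ), E' ⊆ H.edges ∧ E'.Nonempty ∧
      r = (imageEdges ord f E' : ℝ) / (imageVerts f E' : ℝ)}}

/-- The set of 3-edges `E` contains a Berge cycle: `t ≥ 2` distinct vertices and `t` distinct
edges with `v i, v (i+1) ∈ e i` cyclically. -/
def HasBergeCycle (E : Set (Finset ℕ)) : Prop :=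
  ∃ t : ℕ, 2 ≤ t ∧ ∃ (v : ZMod t → ℕ) (e : ZMod t → Finset ℕ),
    Function.Injective v ∧ Function.Injective e ∧
    ∀ i : ZMod t, e i ∈ E ∧ v i ∈ e i ∧ v (i + 1) ∈ e i

/-- `H` is avoidable: for every ordering and every pair homomorphism `f` from `H` to an
oriented 3-graph, the 3-graph of underlying vertex sets of the image edges has a Berge cycle. -/
def Avoidable (H : ThreeGraph) : Prop :=
  ∀ (ord : ℕ → ℕ) (E : Set (ℕ × ℕ × ℕ)) (f : Finset ℕ → ℕ),
    Oriented E → IsPairHom H ord E f →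
    HasBergeCycle {s : Finset ℕ | ∃ e ∈ H.edges, ∃ u v w : ℕ,
      e = ({u, v, w} : Finset ℕ) ∧ ord u < ord v ∧ ord v < ord w ∧
      s = ({f {u, v}, f {v, w}, f {u, w}} : Finset ℕ)}

/-- A linear 3-graph: any two distinct edges share at most one vertex. -/
def LinearTG (F : ThreeGraph) : Prop :=
  ∀ e₁ ∈ F.edges, ∀ e₂ ∈ F.edges, e₁ ≠ e₂ → (e₁ ∩ e₂).card ≤ 1
/-- The tight cycle `C_n^{(3)}`: vertex set `{0,…,n-1}` (standing for `ℤ/n`), edges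
`{k, k+1, k+2}` with arithmetic modulo `n`. -/
def tightCycle (n : ℕ) : ThreeGraph where
  verts := Finset.range n
  edges := ((Finset.range n).powersetCard 3).filter (fun e =>
    ∃ k < n, e = ({k, (k + 1) % n, (k + 2) % n} : Finset ℕ))
  card_eq := fun e he => (Finset.mem_powersetCard.mp (Finset.mem_filter.mp he).1).2
  subset_verts := fun e he => (Finset.mem_powersetCard.mp (Finset.mem_filter.mp he).1).1

/-! ### Generalities on image triples -/

/-- The set of image triples. -/
def imgSet (ord : ℕ → ℕ) (f : Finset ℕ → ℕ) (E' : Finset (Finset ℕ)) : Set (ℕ × ℕ × ℕ) :=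
  {p : ℕ × ℕ × ℕ | ∃ e ∈ E', ∃ u v w : ℕ,
    e = ({u, v, w} : Finset ℕ) ∧ ord u < ord v ∧ ord v < ord w ∧
    p = (f {u, v}, f {v, w}, f {u, w})}

lemma pair_mem_shadow {E' : Finset (Finset ℕ)} {e : Finset ℕ} (he : e ∈ E') {u v : ℕ}
    (hu : u ∈ e) (hv : v ∈ e) (huv : u ≠ v) : ({u, v} : Finset ℕ) ∈ shadowOf E' := by
  unfold shadowOf
  rw [Finset.mem_biUnion]
  refine ⟨e, he, ?_⟩
  rw [Finset.mem_powersetCard]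
  refine ⟨?_, Finset.card_pair huv⟩
  intro x hx
  simp only [Finset.mem_insert, Finset.mem_singleton] at hx
  rcases hx with rfl | rfl <;> assumption

lemma imgSet_comp (ord : ℕ → ℕ) (f : Finset ℕ → ℕ) (E' : Finset (Finset ℕ)) (a b c : ℕ)
    (h : (a, b, c) ∈ imgSet ord f E') :
    a ∈ (shadowOf E').image f ∧ b ∈ (shadowOf E').image f ∧ c ∈ (shadowOf E').image f := by
  obtain ⟨e, he, u, v, w, rfl, h1, h2, h3⟩ := h
  simp only [Prod.mk.injEq] at h3
  obtain ⟨rfl, rfl, rfl⟩ := h3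
  have huv : u ≠ v := by rintro rfl; omega
  have hvw : v ≠ w := by rintro rfl; omega
  have huw : u ≠ w := by rintro rfl; omega
  refine ⟨Finset.mem_image_of_mem _ (pair_mem_shadow he ?_ ?_ huv),
    Finset.mem_image_of_mem _ (pair_mem_shadow he ?_ ?_ hvw),
    Finset.mem_image_of_mem _ (pair_mem_shadow he ?_ ?_ huw)⟩ <;> simp

lemma imgSet_finite (ord : ℕ → ℕ) (f : Finset ℕ → ℕ) (E' : Finset (Finset ℕ)) :
    (imgSet ord f E').Finite := by
  apply Set.Finite.subset
    (Finset.finite_toSet ((shadowOf E').image f ×ˢ (shadowOf E').image f ×ˢ (shadowOf E').image f))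
  rintro ⟨a, b, c⟩ h
  have := imgSet_comp ord f E' a b c h
  simp only [Finset.coe_product, Set.mem_prod, Finset.mem_coe]
  exact this

/-- The set of ratios. -/
def ratios (H : ThreeGraph) (ord : ℕ → ℕ) (f : Finset ℕ → ℕ) : Set ℝ :=
  {r : ℝ | ∃ E' : Finset (Finset ℕ), E' ⊆ H.edges ∧ E'.Nonempty ∧
      r = (imageEdges ord f E' : ℝ) / (imageVerts f E' : ℝ)}

lemma ratios_bdd (H : ThreeGraph) (ord : ℕ → ℕ) (f : Finset ℕ → ℕ) :
    BddAbove (ratios H ord f) := by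
  apply Set.Finite.bddAbove
  apply Set.Finite.subset (Finset.finite_toSet (H.edges.powerset.image
    (fun E' => (imageEdges ord f E' : ℝ) / (imageVerts f E' : ℝ))))
  rintro r ⟨E', h1, -, rfl⟩
  simp only [Finset.coe_image, Set.mem_image, Finset.mem_coe, Finset.mem_powerset]
  exact ⟨E', h1, rfl⟩

lemma ratios_nonneg (H : ThreeGraph) (ord : ℕ → ℕ) (f : Finset ℕ → ℕ) :
    0 ≤ sSup (ratios H ord f) := by
  apply Real.sSup_nonneg
  rintro r ⟨E', -, -, rfl⟩
  positivity

lemma mpair_eq_of (H : ThreeGraph) (c : ℝ)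
    (hlow : ∀ (ord : ℕ → ℕ) (E : Set (ℕ × ℕ × ℕ)) (f : Finset ℕ → ℕ),
      Oriented E → IsPairHom H ord E f → c ≤ sSup (ratios H ord f))
    (hup : ∃ (ord : ℕ → ℕ) (E : Set (ℕ × ℕ × ℕ)) (f : Finset ℕ → ℕ),
      Oriented E ∧ IsPairHom H ord E f ∧ sSup (ratios H ord f) ≤ c) : mpair H = c := by
  obtain ⟨ord, E, f, h1, h2, h3⟩ := hup
  unfold mpair
  apply le_antisymm
  · refine le_trans (csInf_le ?_ ⟨ord, E, f, h1, h2, rfl⟩) h3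
    refine ⟨0, ?_⟩
    rintro q ⟨ord, E, f, -, -, rfl⟩
    exact ratios_nonneg H ord f
  · apply le_csInf
    · exact ⟨_, ord, E, f, h1, h2, rfl⟩
    · rintro q ⟨ord, E, f, h1, h2, rfl⟩
      exact hlow ord E f h1 h2

/-! ### The abstract potential lemma -/

/-- The vertices of a triple. -/
def vs (t : ℕ × ℕ × ℕ) : Finset ℕ := {t.1, t.2.1, t.2.2}

/-- `φ` is a potential on signed vertices that increases by one along both directed triangles of
the oriented triple `t`. -/
def Valid (φ : ℕ → Bool → ZMod 3) (t : ℕ × ℕ × ℕ) : Prop :=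
  φ t.2.1 true = φ t.1 true + 1 ∧ φ t.2.2 false = φ t.2.1 true + 1 ∧
  φ t.1 true = φ t.2.2 false + 1 ∧
  φ t.2.2 true = φ t.1 false + 1 ∧ φ t.2.1 false = φ t.2.2 true + 1 ∧
  φ t.1 false = φ t.2.1 false + 1

lemma Valid.congr {φ ψ : ℕ → Bool → ZMod 3} {t : ℕ × ℕ × ℕ} (h : Valid φ t)
    (hh : ∀ v ∈ vs t, ψ v = φ v) : Valid ψ t := by
  unfold Valid at *
  rw [hh t.1 (by simp [vs]), hh t.2.1 (by simp [vs]), hh t.2.2 (by simp [vs])]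
  exact h

lemma three_zmod (x : ZMod 3) : x = x + 1 + 1 + 1 := by
  revert x; decide

lemma extend_valid (φ : ℕ → Bool → ZMod 3) (B : Finset ℕ) (t : ℕ × ℕ × ℕ) (x : ℕ)
    (hx : x ∈ vs t) (hxB : x ∈ B) (hcard : B.card + 2 ≤ (B ∪ vs t).card) :
    ∃ ψ : ℕ → Bool → ZMod 3, (∀ v ∈ B, ψ v = φ v) ∧ Valid ψ t := by
  obtain ⟨a, b, c⟩ := t
  -- two new vertices
  have key : ∀ y z : ℕ, vs (a, b, c) = {x, y, z} → y ∉ B ∧ z ∉ B ∧ y ≠ z := by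
    intro y z h
    rw [h] at hcard
    by_contra hcon
    have : ∃ w : ℕ, B ∪ {x, y, z} ⊆ insert w B := by
      by_cases hy : y ∈ B
      · refine ⟨z, ?_⟩
        intro v hv
        simp only [Finset.mem_union, Finset.mem_insert, Finset.mem_singleton] at hv ⊢
        rcases hv with hv | rfl | rfl | rfl <;> tauto
      · refine ⟨y, ?_⟩
        have : z ∈ B ∨ y = z := by tauto
        intro v hv
        simp only [Finset.mem_union, Finset.mem_insert, Finset.mem_singleton] at hv ⊢
        rcases hv with hv | rfl | rfl | rfl
        · tauto
        · tauto
        · tauto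
        · rcases this with h | h
          · tauto
          · exact Or.inl h.symm
    obtain ⟨w, hw⟩ := this
    have h1 := Finset.card_le_card hw
    have h2 := Finset.card_insert_le w B
    omega
  simp only [vs, Finset.mem_insert, Finset.mem_singleton] at hx
  rcases hx with rfl | rfl | rfl
  · obtain ⟨hb, hc, hbc⟩ := key b c rfl
    have hxb : x ≠ b := by rintro rfl; exact hb hxB
    have hxc : x ≠ c := by rintro rfl; exact hc hxB
    refine ⟨fun v s => if v = b then (if s then φ x true + 1 else φ x false + 1 + 1)
      else if v = c then (if s then φ x false + 1 else φ x true + 1 + 1) else φ v s, ?_, ?_⟩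
    · intro v hv
      have h1 : v ≠ b := by rintro rfl; exact hb hv
      have h2 : v ≠ c := by rintro rfl; exact hc hv
      funext s
      simp [h1, h2]
    · simp only [Valid, hbc.symm, hxb, hxc, if_true, if_false]
      simp [← three_zmod]
  · obtain ⟨ha, hc, hac⟩ := key a c (by simp only [vs]; ext; simp; tauto)
    have hxa : x ≠ a := by rintro rfl; exact ha hxB
    have hxc : x ≠ c := by rintro rfl; exact hc hxB
    refine ⟨fun v s => if v = c then (if s then φ x false + 1 + 1 else φ x true + 1)
      else if v = a then (if s then φ x true + 1 + 1 else φ x false + 1) else φ v s, ?_, ?_⟩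
    · intro v hv
      have h1 : v ≠ a := by rintro rfl; exact ha hv
      have h2 : v ≠ c := by rintro rfl; exact hc hv
      funext s
      simp [h1, h2]
    · simp only [Valid, hac, hxa, hxc, if_true, if_false]
      simp [← three_zmod]
  · obtain ⟨ha, hb, hab⟩ := key a b (by simp only [vs]; ext; simp; tauto)
    have hxa : x ≠ a := by rintro rfl; exact ha hxB
    have hxb : x ≠ b := by rintro rfl; exact hb hxB
    refine ⟨fun v s => if v = a then (if s then φ x false + 1 else φ x true + 1 + 1)
      else if v = b then (if s then φ x false + 1 + 1 else φ x true + 1) else φ v s, ?_, ?_⟩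
    · intro v hv
      have h1 : v ≠ a := by rintro rfl; exact ha hv
      have h2 : v ≠ b := by rintro rfl; exact hb hv
      funext s
      simp [h1, h2]
    · simp only [Valid, hab.symm, hxa, hxb, if_true, if_false]
      simp [← three_zmod]

/-- Vertices seen up to time `k`. -/
def seenV (T : ℕ → ℕ × ℕ × ℕ) (x0 : ℕ) (k : ℕ) : Finset ℕ :=
  insert x0 ((Finset.range k).biUnion (fun i => vs (T i)))

lemma seenV_succ (T : ℕ → ℕ × ℕ × ℕ) (x0 : ℕ) (k : ℕ) :
    seenV T x0 (k + 1) = seenV T x0 k ∪ vs (T k) := by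
  unfold seenV
  rw [Finset.range_add_one, Finset.biUnion_insert]
  ext v
  simp only [Finset.mem_insert, Finset.mem_union]
  tauto

lemma potential (T : ℕ → ℕ × ℕ × ℕ) (x : ℕ → ℕ) (hx1 : ∀ k, x k ∈ vs (T k))
    (hx2 : ∀ k, x (k + 1) ∈ vs (T k))
    (hcard : ∀ k, 2 * ((Finset.range k).image T).card + 1 ≤ (seenV T (x 0) k).card) (k : ℕ) :
    (seenV T (x 0) k).card ≤ 2 * ((Finset.range k).image T).card + 1 ∧
    ∃ φ : ℕ → Bool → ZMod 3, ∀ i < k, Valid φ (T i) := by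
  induction k with
  | zero =>
    refine ⟨by simp [seenV], fun _ _ => 0, by simp⟩
  | succ k ih =>
    obtain ⟨ih1, φ, hφ⟩ := ih
    have hxk : x k ∈ seenV T (x 0) k := by
      cases k with
      | zero => simp [seenV]
      | succ j => rw [seenV_succ]; exact Finset.mem_union_right _ (hx2 j)
    have hsub : ∀ i < k, vs (T i) ⊆ seenV T (x 0) k := by
      intro i hi v hv
      unfold seenV
      apply Finset.mem_insert_of_mem
      rw [Finset.mem_biUnion]
      exact ⟨i, Finset.mem_range.2 hi, hv⟩
    by_cases hk : T k ∈ (Finset.range k).image T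
    · have hT : (Finset.range (k + 1)).image T = (Finset.range k).image T := by
        rw [Finset.range_add_one, Finset.image_insert, Finset.insert_eq_of_mem hk]
      rw [Finset.mem_image] at hk
      obtain ⟨i, hi, hik⟩ := hk
      rw [Finset.mem_range] at hi
      rw [seenV_succ, Finset.union_eq_left.2 (hik ▸ hsub i hi), hT]
      refine ⟨ih1, φ, ?_⟩
      intro j hj
      rcases Nat.lt_succ_iff_lt_or_eq.1 hj with h | h
      · exact hφ j h
      · rw [h, ← hik]; exact hφ i hi
    · have hT : ((Finset.range (k + 1)).image T).card = ((Finset.range k).image T).card + 1 := by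
        rw [Finset.range_add_one, Finset.image_insert, Finset.card_insert_of_notMem hk]
      have hc := hcard (k + 1)
      rw [hT] at hc ⊢
      rw [seenV_succ] at hc ⊢
      constructor
      · have h1 : seenV T (x 0) k ∪ vs (T k) ⊆ seenV T (x 0) k ∪ (vs (T k)).erase (x k) := by
          intro v hv
          simp only [Finset.mem_union, Finset.mem_erase] at hv ⊢
          by_cases hvx : v = x k
          · left; rw [hvx]; exact hxk
          · tauto
        have h2 := Finset.card_le_card h1
        have h3 := Finset.card_union_le (seenV T (x 0) k) ((vs (T k)).erase (x k))
        have h4 := Finset.card_erase_of_mem (hx1 k)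
        have h5 : (vs (T k)).card ≤ 3 := Finset.card_le_three
        omega
      · obtain ⟨ψ, h1, h2⟩ := extend_valid φ (seenV T (x 0) k) (T k) (x k) (hx1 k) hxk (by omega)
        refine ⟨ψ, ?_⟩
        intro j hj
        rcases Nat.lt_succ_iff_lt_or_eq.1 hj with h | h
        · exact (hφ j h).congr (fun v hv => h1 v (hsub j h hv))
        · rw [h]; exact h2

/-! ### The local step -/

lemma local_step (ord : ℕ → ℕ) (f : Finset ℕ → ℕ) (p q r : ℕ) (hpq : ord p ≠ ord q)
    (hqr : ord q ≠ ord r) (hpr : ord p ≠ ord r) :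
    ∃ t : ℕ × ℕ × ℕ, (∃ u v w : ℕ, ({p, q, r} : Finset ℕ) = {u, v, w} ∧ ord u < ord v ∧
        ord v < ord w ∧ t = (f {u, v}, f {v, w}, f {u, w})) ∧
      f {p, q} ∈ vs t ∧ f {q, r} ∈ vs t ∧ f {p, r} ∈ vs t ∧
      ∀ φ : ℕ → Bool → ZMod 3, Valid φ t →
        φ (f {q, r}) (decide (ord q < ord r)) = φ (f {p, q}) (decide (ord p < ord q)) + 1 := by
  have cq : f {q, p} = f {p, q} := by rw [Finset.pair_comm]
  have cr : f {r, q} = f {q, r} := by rw [Finset.pair_comm]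
  have cp : f {r, p} = f {p, r} := by rw [Finset.pair_comm]
  rcases lt_or_gt_of_ne hpq with h1 | h1 <;> rcases lt_or_gt_of_ne hqr with h2 | h2 <;>
    rcases lt_or_gt_of_ne hpr with h3 | h3
  · refine ⟨_, ⟨p, q, r, by ext; simp, h1, h2, rfl⟩, ?_⟩
    simp [vs, Valid, cq, cr, cp, h1, h2, h1.le, h2.le] <;> grind
  · omega
  · refine ⟨_, ⟨p, r, q, by ext; simp; tauto, h3, h2, rfl⟩, ?_⟩
    simp [vs, Valid, cq, cr, cp, h1, h2, h1.le, h2.le] <;> grind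
  · refine ⟨_, ⟨r, p, q, by ext; simp; tauto, h3, h1, rfl⟩, ?_⟩
    simp [vs, Valid, cq, cr, cp, h1, h2, h1.le, h2.le] <;> grind
  · refine ⟨_, ⟨q, p, r, by ext; simp; tauto, h1, h3, rfl⟩, ?_⟩
    simp [vs, Valid, cq, cr, cp, h1, h2, h1.le, h2.le] <;> grind
  · refine ⟨_, ⟨q, r, p, by ext; simp; tauto, h2, h3, rfl⟩, ?_⟩
    simp [vs, Valid, cq, cr, cp, h1, h2, h1.le, h2.le] <;> grind
  · omega
  · refine ⟨_, ⟨r, q, p, by ext; simp; tauto, h2, h1, rfl⟩, ?_⟩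
    simp [vs, Valid, cq, cr, cp, h1, h2, h1.le, h2.le] <;> grind

/-! ### The tight cycle -/

/-- The `k`-th edge. -/
def cyc (n k : ℕ) : Finset ℕ := {k % n, (k + 1) % n, (k + 2) % n}

lemma succ_mod (n k : ℕ) (hn : 5 ≤ n) :
    (k + 1) % n = if k % n + 1 < n then k % n + 1 else 0 := by
  have hr : k % n < n := Nat.mod_lt _ (by omega)
  have : (k + 1) % n = (k % n + 1) % n := by simp
  rw [this]
  split_ifs with h
  · exact Nat.mod_eq_of_lt h
  · have : k % n + 1 = n := by omega
    rw [this]; simp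

lemma mod_facts (n k : ℕ) (hn : 5 ≤ n) : k % n < n ∧ (k + 1) % n < n ∧ (k + 2) % n < n ∧
    k % n ≠ (k + 1) % n ∧ (k + 1) % n ≠ (k + 2) % n ∧ k % n ≠ (k + 2) % n := by
  have h1 := succ_mod n k hn
  have h2 := succ_mod n (k + 1) hn
  have hr : k % n < n := Nat.mod_lt _ (by omega)
  rw [show k + 1 + 1 = k + 2 from rfl] at h2
  rw [h1] at h2
  rw [h2, h1]
  split_ifs <;> omega

lemma cyc_mem (n k : ℕ) (hn : 5 ≤ n) : cyc n k ∈ (tightCycle n).edges := by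
  obtain ⟨h1, h2, h3, h4, h5, h6⟩ := mod_facts n k hn
  simp only [tightCycle, Finset.mem_filter, Finset.mem_powersetCard]
  refine ⟨⟨?_, ?_⟩, k % n, h1, ?_⟩
  · intro v hv
    simp only [cyc, Finset.mem_insert, Finset.mem_singleton] at hv
    rw [Finset.mem_range]
    rcases hv with rfl | rfl | rfl <;> assumption
  · exact Finset.card_eq_three.2 ⟨_, _, _, h4, h6, h5, rfl⟩
  · simp [cyc]

lemma shadow_verts_pos (f : Finset ℕ → ℕ) (E' : Finset (Finset ℕ)) (n : ℕ)
    (hE : E' ⊆ (tightCycle n).edges) (hne : E'.Nonempty) : 0 < imageVerts f E' := by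
  obtain ⟨e, he⟩ := hne
  have hc := (tightCycle n).card_eq e (hE he)
  obtain ⟨a, b, c, hab, -, -, rfl⟩ := Finset.card_eq_three.1 hc
  unfold imageVerts
  rw [Finset.card_pos]
  exact ⟨_, Finset.mem_image_of_mem f (pair_mem_shadow he (by simp) (by simp) hab)⟩

lemma steps_exist (n : ℕ) (hn : 5 ≤ n) (ord : ℕ → ℕ) (f : Finset ℕ → ℕ)
    (hinj : Set.InjOn ord ↑(tightCycle n).verts) (k : ℕ) :
    ∃ t : ℕ × ℕ × ℕ, (∃ u v w : ℕ, cyc n k = {u, v, w} ∧ ord u < ord v ∧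
        ord v < ord w ∧ t = (f {u, v}, f {v, w}, f {u, w})) ∧
      f {k % n, (k + 1) % n} ∈ vs t ∧ f {(k + 1) % n, (k + 2) % n} ∈ vs t ∧
      f {k % n, (k + 2) % n} ∈ vs t ∧
      ∀ φ : ℕ → Bool → ZMod 3, Valid φ t →
        φ (f {(k + 1) % n, (k + 2) % n}) (decide (ord ((k + 1) % n) < ord ((k + 2) % n)))
          = φ (f {k % n, (k + 1) % n}) (decide (ord (k % n) < ord ((k + 1) % n))) + 1 := by
  obtain ⟨h1, h2, h3, h4, h5, h6⟩ := mod_facts n k hn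
  have hm : ∀ v, v < n → v ∈ (↑(tightCycle n).verts : Set ℕ) := by
    intro v hv; simpa [tightCycle] using hv
  exact local_step ord f _ _ _ (fun h => h4 (hinj (hm _ h1) (hm _ h2) h))
    (fun h => h5 (hinj (hm _ h2) (hm _ h3) h)) (fun h => h6 (hinj (hm _ h1) (hm _ h3) h))

lemma pair_image_mem (f : Finset ℕ → ℕ) (n k : ℕ) (t : ℕ × ℕ × ℕ)
    (h1 : f {k % n, (k + 1) % n} ∈ vs t) (h2 : f {(k + 1) % n, (k + 2) % n} ∈ vs t)
    (h3 : f {k % n, (k + 2) % n} ∈ vs t) (s : Finset ℕ) (hs : s ∈ (cyc n k).powersetCard 2) :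
    f s ∈ vs t := by
  rw [Finset.mem_powersetCard] at hs
  obtain ⟨hs1, hs2⟩ := hs
  obtain ⟨a, b, hab, rfl⟩ := Finset.card_eq_two.1 hs2
  have ha : a ∈ cyc n k := hs1 (by simp)
  have hb : b ∈ cyc n k := hs1 (by simp)
  simp only [cyc, Finset.mem_insert, Finset.mem_singleton] at ha hb
  rcases ha with rfl | rfl | rfl <;> rcases hb with rfl | rfl | rfl
  · exact absurd rfl hab
  · exact h1
  · exact h3
  · rw [Finset.pair_comm]; exact h1
  · exact absurd rfl hab
  · exact h2
  · rw [Finset.pair_comm]; exact h3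
  · rw [Finset.pair_comm]; exact h2
  · exact absurd rfl hab

lemma initial_counts (n : ℕ) (ord : ℕ → ℕ) (f : Finset ℕ → ℕ)
    (T : ℕ → ℕ × ℕ × ℕ)
    (hT : ∀ k, (∃ u v w : ℕ, cyc n k = {u, v, w} ∧ ord u < ord v ∧
        ord v < ord w ∧ T k = (f {u, v}, f {v, w}, f {u, w})))
    (h1 : ∀ k, f {k % n, (k + 1) % n} ∈ vs (T k))
    (h2 : ∀ k, f {(k + 1) % n, (k + 2) % n} ∈ vs (T k))
    (h3 : ∀ k, f {k % n, (k + 2) % n} ∈ vs (T k)) (k : ℕ) :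
    ((Finset.range k).image T).card ≤ imageEdges ord f ((Finset.range k).image (cyc n)) ∧
    imageVerts f ((Finset.range k).image (cyc n)) ≤
      ((Finset.range k).biUnion (fun i => vs (T i))).card := by
  constructor
  · rw [← Set.ncard_coe_finset]
    apply Set.ncard_le_ncard _ (imgSet_finite ord f _)
    intro t ht
    simp only [Finset.coe_image, Set.mem_image, Finset.mem_coe] at ht
    obtain ⟨i, hi, rfl⟩ := ht
    exact ⟨cyc n i, Finset.mem_image_of_mem _ hi, hT i⟩
  · apply Finset.card_le_card
    intro x hx
    simp only [shadowOf, Finset.mem_image, Finset.mem_biUnion] at hx ⊢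
    obtain ⟨s, ⟨e, ⟨i, hi, rfl⟩, hs⟩, rfl⟩ := hx
    exact ⟨i, hi, pair_image_mem f n i (T i) (h1 i) (h2 i) (h3 i) s hs⟩

lemma lower_third (n : ℕ) (hn : 5 ≤ n) (ord : ℕ → ℕ) (f : Finset ℕ → ℕ)
    (hinj : Set.InjOn ord ↑(tightCycle n).verts) :
    1 / 3 ≤ sSup (ratios (tightCycle n) ord f) := by
  choose T hT h1 h2 h3 h4 using steps_exist n hn ord f hinj
  obtain ⟨a, b⟩ := initial_counts n ord f T hT h1 h2 h3 1
  have hsub : (Finset.range 1).image (cyc n) ⊆ (tightCycle n).edges := by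
    intro e he
    simp only [Finset.mem_image] at he
    obtain ⟨i, -, rfl⟩ := he
    exact cyc_mem n i hn
  have hne : ((Finset.range 1).image (cyc n)).Nonempty := by simp
  have hpos := shadow_verts_pos f _ n hsub hne
  refine le_trans ?_ (le_csSup (ratios_bdd (tightCycle n) ord f) ⟨_, hsub, hne, rfl⟩)
  have a' : 1 ≤ imageEdges ord f ((Finset.range 1).image (cyc n)) := by simpa using a
  have b' : imageVerts f ((Finset.range 1).image (cyc n)) ≤ 3 := by
    refine b.trans ?_
    simp only [Finset.range_one, Finset.singleton_biUnion]
    exact Finset.card_le_three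
  rw [div_le_div_iff₀ (by norm_num) (by exact_mod_cast hpos)]
  exact_mod_cast (by omega : 1 * imageVerts f ((Finset.range 1).image (cyc n)) ≤
    imageEdges ord f ((Finset.range 1).image (cyc n)) * 3)

lemma lower_half (n : ℕ) (hn : 5 ≤ n) (h3n : ¬ 3 ∣ n) (ord : ℕ → ℕ) (f : Finset ℕ → ℕ)
    (hinj : Set.InjOn ord ↑(tightCycle n).verts) :
    1 / 2 ≤ sSup (ratios (tightCycle n) ord f) := by
  by_contra hcon
  rw [not_le] at hcon
  choose T hT h1 h2 h3 h4 using steps_exist n hn ord f hinj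
  have hcard : ∀ k, 2 * ((Finset.range k).image T).card + 1 ≤
      (seenV T (f {0 % n, (0 + 1) % n}) k).card := by
    intro k
    rcases Nat.eq_zero_or_pos k with rfl | hk
    · simp [seenV]
    obtain ⟨a, b⟩ := initial_counts n ord f T hT h1 h2 h3 k
    have hsub : (Finset.range k).image (cyc n) ⊆ (tightCycle n).edges := by
      intro e he
      simp only [Finset.mem_image] at he
      obtain ⟨i, -, rfl⟩ := he
      exact cyc_mem n i hn
    have hne : ((Finset.range k).image (cyc n)).Nonempty := by
      rw [Finset.image_nonempty, Finset.nonempty_range_iff]; omega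
    have hpos := shadow_verts_pos f _ n hsub hne
    have hlt := lt_of_le_of_lt
      (le_csSup (ratios_bdd (tightCycle n) ord f) ⟨_, hsub, hne, rfl⟩) hcon
    rw [div_lt_div_iff₀ (by exact_mod_cast hpos) (by norm_num)] at hlt
    have hlt' : imageEdges ord f ((Finset.range k).image (cyc n)) * 2 <
      1 * imageVerts f ((Finset.range k).image (cyc n)) := by exact_mod_cast hlt
    have hle : ((Finset.range k).biUnion (fun i => vs (T i))).card ≤
        (seenV T (f {0 % n, (0 + 1) % n}) k).card :=
      Finset.card_le_card (Finset.subset_insert _ _)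
    omega
  obtain ⟨-, φ, hφ⟩ := potential T (fun k => f {k % n, (k + 1) % n}) h1 h2 hcard n
  have hstep : ∀ k ≤ n, φ (f {k % n, (k + 1) % n}) (decide (ord (k % n) < ord ((k + 1) % n))) =
      φ (f {0 % n, (0 + 1) % n}) (decide (ord (0 % n) < ord ((0 + 1) % n))) + (k : ZMod 3) := by
    intro k
    induction k with
    | zero => intro _; simp
    | succ k ih =>
      intro hk
      have := h4 k φ (hφ k (by omega))
      rw [show k + 1 + 1 = k + 2 from rfl, this, ih (by omega)]
      push_cast
      ring
  have hfin := hstep n le_rfl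
  have e1 : n % n = 0 % n := by simp
  have e2 : (n + 1) % n = (0 + 1) % n := by simp
  rw [e1, e2] at hfin
  have : (n : ZMod 3) = 0 := by
    have := hfin.symm
    simpa using this
  rw [ZMod.natCast_eq_zero_iff] at this
  exact h3n this

/-! ### The construction -/

/-- Classes of vertices. -/
def gcl (L k : ℕ) : ℕ :=
  if k < L then k else if (k - L) % 3 = 2 then L - 1 else (k - L) % 3

/-- The ordering: first by class. -/
def gord (n L k : ℕ) : ℕ := gcl L k * n + k

/-- Colour of an ordered pair. -/
def code (L u v : ℕ) : ℕ :=
  if gcl L u % 2 = 0 then (if gcl L v % 2 = 0 then 2 else 0)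
  else (if gcl L v % 2 = 0 then 1 else 3)

open Classical in
/-- The pair map. -/
noncomputable def fmap (n L : ℕ) (s : Finset ℕ) : ℕ :=
  if h : ∃ p : ℕ × ℕ, s = {p.1, p.2} ∧ gord n L p.1 < gord n L p.2 then
    code L h.choose.1 h.choose.2 else 0

lemma fmap_eq (n L u v : ℕ) (h : gord n L u < gord n L v) : fmap n L {u, v} = code L u v := by
  have hex : ∃ p : ℕ × ℕ, ({u, v} : Finset ℕ) = {p.1, p.2} ∧ gord n L p.1 < gord n L p.2 :=
    ⟨(u, v), rfl, h⟩
  unfold fmap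
  rw [dif_pos hex]
  obtain ⟨hp1, hp2⟩ := hex.choose_spec
  generalize hex.choose = p at hp1 hp2
  obtain ⟨a, b⟩ := p
  simp only at hp1 hp2 ⊢
  have ha : a ∈ ({u, v} : Finset ℕ) := by rw [hp1]; simp
  have hb : b ∈ ({u, v} : Finset ℕ) := by rw [hp1]; simp
  simp only [Finset.mem_insert, Finset.mem_singleton] at ha hb
  rcases ha with rfl | rfl <;> rcases hb with rfl | rfl
  · omega
  · rfl
  · omega
  · omega

lemma gord_le (n L u v : ℕ) (hv : v < n) (h : gord n L u < gord n L v) :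
    gcl L u ≤ gcl L v := by
  by_contra hcon
  rw [not_le] at hcon
  unfold gord at h
  have : (gcl L v + 1) * n ≤ gcl L u * n := Nat.mul_le_mul_right _ hcon
  rw [add_mul] at this
  omega

lemma gord_inj (n L u v : ℕ) (hu : u < n) (hv : v < n) (h : gord n L u = gord n L v) : u = v := by
  rcases lt_trichotomy (gcl L u) (gcl L v) with h1 | h1 | h1
  · unfold gord at h
    have : (gcl L u + 1) * n ≤ gcl L v * n := Nat.mul_le_mul_right _ h1
    rw [add_mul] at this
    omega
  · unfold gord at h
    rw [h1] at h
    omega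
  · unfold gord at h
    have : (gcl L v + 1) * n ≤ gcl L u * n := Nat.mul_le_mul_right _ h1
    rw [add_mul] at this
    omega

set_option maxHeartbeats 4000000 in
/-- The classes along an edge are one of the allowed cyclic patterns. -/
lemma class_pattern (n L m k : ℕ) (hn : 5 ≤ n) (hL : L = 3 ∨ L = 5 ∨ L = 7) (hm : n = L + 3 * m)
    (hk : k < n) (p q r : ℕ) (hp : p = gcl L k) (hq : q = gcl L ((k + 1) % n))
    (hr : r = gcl L ((k + 2) % n)) :
    (q = p + 1 ∧ r = p + 2 ∧ r < L) ∨ (p = L - 2 ∧ q = L - 1 ∧ r = 0) ∨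
      (p = L - 1 ∧ q = 0 ∧ r = 1) ∨ (p = 0 ∧ q = 1 ∧ r = L - 1) ∨
      (p = 1 ∧ q = L - 1 ∧ r = 0) := by
  have hcase : (k + 2 < n ∧ (k + 1) % n = k + 1 ∧ (k + 2) % n = k + 2) ∨
      (k + 2 = n ∧ (k + 1) % n = k + 1 ∧ (k + 2) % n = 0) ∨
      (k + 1 = n ∧ (k + 1) % n = 0 ∧ (k + 2) % n = 1) := by
    have h1 := succ_mod n k hn
    have h2 := succ_mod n (k + 1) hn
    rw [show k + 1 + 1 = k + 2 from rfl, h1] at h2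
    rw [Nat.mod_eq_of_lt hk] at h1 h2
    rw [h1, h2]
    split_ifs <;> omega
  rcases hcase with ⟨hc, e1, e2⟩ | ⟨hc, e1, e2⟩ | ⟨hc, e1, e2⟩ <;> rw [e1] at hq <;>
    rw [e2] at hr <;> clear e1 e2 <;> unfold gcl at hp hq hr <;>
    rcases hL with rfl | rfl | rfl <;> split_ifs at hp hq hr <;>
    subst hp hq hr <;>
    first
    | (exfalso; omega)
    | exact Or.inl (by omega)
    | exact Or.inr (Or.inl (by omega))
    | exact Or.inr (Or.inr (Or.inl (by omega)))
    | exact Or.inr (Or.inr (Or.inr (Or.inl (by omega))))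
    | exact Or.inr (Or.inr (Or.inr (Or.inr (by omega))))

lemma sorted_parity (n L m k : ℕ) (hn : 5 ≤ n) (hL : L = 3 ∨ L = 5 ∨ L = 7) (hm : n = L + 3 * m)
    (hk : k < n) (u v w : ℕ) (he : ({k, (k + 1) % n, (k + 2) % n} : Finset ℕ) = {u, v, w})
    (huv : gord n L u < gord n L v) (hvw : gord n L v < gord n L w) :
    (gcl L u % 2 = 0 ∧ gcl L v % 2 = 1 ∧ gcl L w % 2 = 0) ∨
    (L ≠ 3 ∧ gcl L u % 2 = 1 ∧ gcl L v % 2 = 0 ∧ gcl L w % 2 = 1) := by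
  obtain ⟨-, m2, m3, -, -, -⟩ := mod_facts n k hn
  have hu : u ∈ ({k, (k + 1) % n, (k + 2) % n} : Finset ℕ) := by rw [he]; simp
  have hv : v ∈ ({k, (k + 1) % n, (k + 2) % n} : Finset ℕ) := by rw [he]; simp
  have hw : w ∈ ({k, (k + 1) % n, (k + 2) % n} : Finset ℕ) := by rw [he]; simp
  have hpat := class_pattern n L m k hn hL hm hk _ _ _ rfl rfl rfl
  simp only [Finset.mem_insert, Finset.mem_singleton] at hu hv hw
  have hvn : v < n := by rcases hv with rfl | rfl | rfl <;> assumption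
  have hwn : w < n := by rcases hw with rfl | rfl | rfl <;> assumption
  have l1 := gord_le n L u v hvn huv
  have l2 := gord_le n L v w hwn hvw
  have n1 : u ≠ v := by rintro rfl; omega
  have n2 : v ≠ w := by rintro rfl; omega
  have n3 : u ≠ w := by rintro rfl; omega
  clear he huv hvw hm m2 m3 hvn hwn hn hk
  rcases hu with rfl | rfl | rfl <;> rcases hv with rfl | rfl | rfl <;>
    first
    | exact absurd rfl n1
    | (rcases hw with rfl | rfl | rfl <;>
        first
        | exact absurd rfl n2
        | exact absurd rfl n3
        | (clear n1 n2 n3; rcases hpat with h | h | h | h | h <;> omega))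

lemma fmap_triple (n L m : ℕ) (hn : 5 ≤ n) (hL : L = 3 ∨ L = 5 ∨ L = 7) (hm : n = L + 3 * m)
    (e : Finset ℕ) (he : e ∈ (tightCycle n).edges) (u v w : ℕ) (huvw : e = {u, v, w})
    (huv : gord n L u < gord n L v) (hvw : gord n L v < gord n L w) :
    (fmap n L {u, v} = 0 ∧ fmap n L {v, w} = 1 ∧ fmap n L {u, w} = 2) ∨
    (L ≠ 3 ∧ fmap n L {u, v} = 1 ∧ fmap n L {v, w} = 0 ∧ fmap n L {u, w} = 3) := by
  simp only [tightCycle, Finset.mem_filter] at he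
  obtain ⟨-, k, hk, hek⟩ := he
  rw [fmap_eq n L u v huv, fmap_eq n L v w hvw, fmap_eq n L u w (huv.trans hvw)]
  rcases sorted_parity n L m k hn hL hm hk u v w (hek ▸ huvw) huv hvw with
    ⟨h1, h2, h3⟩ | ⟨h0, h1, h2, h3⟩
  · left; simp [code, h1, h2, h3]
  · right; simp [code, h0, h1, h2, h3]

/-- The target oriented graph. -/
def tgt : Set (ℕ × ℕ × ℕ) := {(0, 1, 2), (1, 0, 3)}

lemma tgt_oriented : Oriented tgt := by
  intro a b c h
  simp only [tgt, Set.mem_insert_iff, Set.mem_singleton_iff, Prod.mk.injEq] at h ⊢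
  omega

lemma fmap_hom (n L m : ℕ) (hn : 5 ≤ n) (hL : L = 3 ∨ L = 5 ∨ L = 7) (hm : n = L + 3 * m) :
    IsPairHom (tightCycle n) (gord n L) tgt (fmap n L) := by
  constructor
  · intro u hu v hv h
    have hu' : u < n := by simpa [tightCycle] using hu
    have hv' : v < n := by simpa [tightCycle] using hv
    exact gord_inj n L u v hu' hv' h
  · intro e he u v w huvw huv hvw
    rcases fmap_triple n L m hn hL hm e he u v w huvw huv hvw with
      ⟨h1, h2, h3⟩ | ⟨h0, h1, h2, h3⟩
    · rw [h1, h2, h3]; simp [tgt]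
    · rw [h1, h2, h3]; simp [tgt]

lemma fmap_ratio (n L m : ℕ) (hn : 5 ≤ n) (hL : L = 3 ∨ L = 5 ∨ L = 7) (hm : n = L + 3 * m)
    (E' : Finset (Finset ℕ)) (hE : E' ⊆ (tightCycle n).edges) (hne : E'.Nonempty) :
    2 * imageEdges (gord n L) (fmap n L) E' ≤ imageVerts (fmap n L) E' ∧
    (L = 3 → 3 * imageEdges (gord n L) (fmap n L) E' ≤ imageVerts (fmap n L) E') := by
  have hsub : ∀ t ∈ imgSet (gord n L) (fmap n L) E', t = (0, 1, 2) ∨ (L ≠ 3 ∧ t = (1, 0, 3)) := by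
    rintro t ⟨e, he, u, v, w, h1, h2, h3, rfl⟩
    rcases fmap_triple n L m hn hL hm e (hE he) u v w h1 h2 h3 with
      ⟨h1, h2, h3⟩ | ⟨h0, h1, h2, h3⟩
    · left; rw [h1, h2, h3]
    · right; rw [h1, h2, h3]; exact ⟨h0, rfl⟩
  have hcomp := imgSet_comp (gord n L) (fmap n L) E'
  have heq : imageEdges (gord n L) (fmap n L) E' = (imgSet (gord n L) (fmap n L) E').ncard := rfl
  rw [heq]
  unfold imageVerts
  set S := imgSet (gord n L) (fmap n L) E'
  set I := (shadowOf E').image (fmap n L)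
  by_cases hA : (0, 1, 2) ∈ S
  · obtain ⟨a0, a1, a2⟩ := hcomp _ _ _ hA
    by_cases hB : (1, 0, 3) ∈ S
    · obtain ⟨-, -, a3⟩ := hcomp _ _ _ hB
      have hL3 : L ≠ 3 := by
        rcases hsub _ hB with h | h
        · simp at h
        · exact h.1
      have hS : S.ncard ≤ 2 := by
        have : S ⊆ {((0 : ℕ), (1 : ℕ), (2 : ℕ)), (1, 0, 3)} := by
          intro t ht
          rcases hsub t ht with h | h
          · simp [h]
          · simp [h.2]
        refine (Set.ncard_le_ncard this (by simp)).trans (Set.ncard_insert_le _ _ |>.trans ?_)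
        simp
      have hI : 4 ≤ I.card := by
        have : ({0, 1, 2, 3} : Finset ℕ) ⊆ I := by
          intro x hx
          simp only [Finset.mem_insert, Finset.mem_singleton] at hx
          rcases hx with rfl | rfl | rfl | rfl <;> assumption
        exact le_trans (by decide) (Finset.card_le_card this)
      omega
    · have hS : S.ncard ≤ 1 := by
        have : S ⊆ {((0 : ℕ), (1 : ℕ), (2 : ℕ))} := by
          intro t ht
          rcases hsub t ht with h | h
          · simp [h]
          · rw [h.2] at ht; exact absurd ht hB
        refine (Set.ncard_le_ncard this (by simp)).trans ?_
        simp
      have hI : 3 ≤ I.card := by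
        have : ({0, 1, 2} : Finset ℕ) ⊆ I := by
          intro x hx
          simp only [Finset.mem_insert, Finset.mem_singleton] at hx
          rcases hx with rfl | rfl | rfl <;> assumption
        exact le_trans (by decide) (Finset.card_le_card this)
      omega
  · by_cases hB : (1, 0, 3) ∈ S
    · obtain ⟨a1, a0, a3⟩ := hcomp _ _ _ hB
      have hS : S.ncard ≤ 1 := by
        have : S ⊆ {((1 : ℕ), (0 : ℕ), (3 : ℕ))} := by
          intro t ht
          rcases hsub t ht with h | h
          · rw [h] at ht; exact absurd ht hA
          · simp [h.2]
        refine (Set.ncard_le_ncard this (by simp)).trans ?_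
        simp
      have hI : 3 ≤ I.card := by
        have : ({0, 1, 3} : Finset ℕ) ⊆ I := by
          intro x hx
          simp only [Finset.mem_insert, Finset.mem_singleton] at hx
          rcases hx with rfl | rfl | rfl <;> assumption
        exact le_trans (by decide) (Finset.card_le_card this)
      omega
    · have hS : S.ncard = 0 := by
        have : S = ∅ := by
          ext t
          simp only [Set.mem_empty_iff_false, iff_false]
          intro ht
          rcases hsub t ht with h | h
          · rw [h] at ht; exact hA ht
          · rw [h.2] at ht; exact hB ht
        rw [this]; simp
      omega

lemma ratios_nonempty (n : ℕ) (hn : 5 ≤ n) (ord : ℕ → ℕ) (f : Finset ℕ → ℕ) :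
    (ratios (tightCycle n) ord f).Nonempty :=
  ⟨_, {cyc n 0}, by simpa using cyc_mem n 0 hn, by simp, rfl⟩

lemma upper_half (n L m : ℕ) (hn : 5 ≤ n) (hL : L = 3 ∨ L = 5 ∨ L = 7) (hm : n = L + 3 * m) :
    sSup (ratios (tightCycle n) (gord n L) (fmap n L)) ≤ 1 / 2 := by
  apply csSup_le (ratios_nonempty n hn _ _)
  rintro r ⟨E', hE, hne, rfl⟩
  have hpos := shadow_verts_pos (fmap n L) E' n hE hne
  have := (fmap_ratio n L m hn hL hm E' hE hne).1
  rw [div_le_div_iff₀ (by exact_mod_cast hpos) (by norm_num)]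
  exact_mod_cast (by omega : imageEdges (gord n L) (fmap n L) E' * 2 ≤
    1 * imageVerts (fmap n L) E')

lemma upper_third (n m : ℕ) (hn : 5 ≤ n) (hm : n = 3 + 3 * m) :
    sSup (ratios (tightCycle n) (gord n 3) (fmap n 3)) ≤ 1 / 3 := by
  apply csSup_le (ratios_nonempty n hn _ _)
  rintro r ⟨E', hE, hne, rfl⟩
  have hpos := shadow_verts_pos (fmap n 3) E' n hE hne
  have := (fmap_ratio n 3 m hn (Or.inl rfl) hm E' hE hne).2 rfl
  rw [div_le_div_iff₀ (by exact_mod_cast hpos) (by norm_num)]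
  exact_mod_cast (by omega : imageEdges (gord n 3) (fmap n 3) E' * 3 ≤
    1 * imageVerts (fmap n 3) E')

/-- For `n ≥ 5`, `m_pair(C_n^{(3)}) = 1/2` if `3 ∤ n` and `= 1/3` if `3 ∣ n`. -/
theorem mpair_tightCycle (n : ℕ) (hn : 5 ≤ n) :
    (¬ (3 ∣ n) → mpair (tightCycle n) = 1 / 2) ∧
    ((3 ∣ n) → mpair (tightCycle n) = 1 / 3) := by
  constructor
  · intro h3
    apply mpair_eq_of
    · intro ord E f _ hf
      exact lower_half n hn h3 ord f hf.1
    · obtain ⟨L, m, hL, hm⟩ : ∃ L m, (L = 3 ∨ L = 5 ∨ L = 7) ∧ n = L + 3 * m := by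
        by_cases h : n % 3 = 2
        · exact ⟨5, (n - 5) / 3, by omega, by omega⟩
        · exact ⟨7, (n - 7) / 3, by omega, by omega⟩
      exact ⟨gord n L, tgt, fmap n L, tgt_oriented, fmap_hom n L m hn hL hm,
        upper_half n L m hn hL hm⟩
  · intro h3
    apply mpair_eq_of
    · intro ord E f _ hf
      exact lower_third n hn ord f hf.1
    · obtain ⟨m, hm⟩ : ∃ m, n = 3 + 3 * m := ⟨(n - 3) / 3, by omega⟩
      exact ⟨gord n 3, tgt, fmap n 3, tgt_oriented, fmap_hom n 3 m hn (Or.inl rfl) hm,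
        upper_third n m hn hm⟩
end

section
/- For all sufficiently large integers k, there is a linear 3-graph F on the vertex set [k] = {1,...,k} with the following three properties (log denotes the natural logarithm): (1) every vertex subset of size ⌈k^{3/5}⌉ contains at least one edge of F; (2) for any two disjoint subsets S, T ⊆ [k] with |S ∪ T| > k/4, |S| > (log k)^2 and |T| > k^{1/2} log k, there is at least one edge of F with one vertex in S and two vertices in T; (3) for any pairwise disjoint subsets A_1, ..., A_t, S ⊆ [k] with |S| > k/4, |A_i| ≤ k^{1/2} log k for all i, and |A_1 ∪ ... ∪ A_t| ≥ k/(16 log k), the number of edges of F with one vertex in S and the other two vertices in two distinct parts A_i, A_j is at least (|S|/(500k)) · Σ_{i ≠ j} |A_i||A_j|, where the sum is over ordered pairs of distinct indices. -/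
open Classical in
/-- Accepted elements of a list: those not in conflict with a later entry. -/
noncomputable def accL {α : Type} (blk : α → α → Prop) : List α → Finset α
  | [] => ∅
  | e :: l => if ∀ e' ∈ l, ¬ blk e e' then insert e (accL blk l) else accL blk l

open Classical in
/-- Elements of `X` not in conflict with any entry of the list. -/
noncomputable def unbL {α : Type} (blk : α → α → Prop) (X : Finset α) (l : List α) : Finset α :=
  X.filter (fun x => ∀ e ∈ l, ¬ blk x e)

theorem mem_unbL {α : Type} (blk : α → α → Prop) (X : Finset α) (l : List α) (x : α) :
    x ∈ unbL blk X l ↔ x ∈ X ∧ ∀ e ∈ l, ¬ blk x e := by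
  simp [unbL]

open Classical in
theorem accL_sub {α : Type} (blk : α → α → Prop) (l : List α) : ∀ x ∈ accL blk l, x ∈ l := by
  induction l with
  | nil => intro x hx; simp [accL] at hx
  | cons e l ih =>
    intro x hx
    unfold accL at hx
    split_ifs at hx
    · rcases Finset.mem_insert.mp hx with h | h
      · simp [h]
      · exact List.mem_cons_of_mem _ (ih x h)
    · exact List.mem_cons_of_mem _ (ih x hx)

open Classical in
theorem accL_indep {α : Type} (blk : α → α → Prop) (hs : ∀ x y, blk x y → blk y x)
    (l : List α) : ∀ x ∈ accL blk l, ∀ y ∈ accL blk l, x ≠ y → ¬ blk x y := by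
  induction l with
  | nil => intro x hx; simp [accL] at hx
  | cons e l ih =>
    intro x hx y hy hxy
    unfold accL at hx hy
    split_ifs at hx hy with h
    · rcases Finset.mem_insert.mp hx with hx' | hx' <;>
        rcases Finset.mem_insert.mp hy with hy' | hy'
      · exact absurd (hx'.trans hy'.symm) hxy
      · rw [hx']; exact h y (accL_sub blk l y hy')
      · rw [hy']; intro hb; exact h x (accL_sub blk l x hx') (hs _ _ hb)
      · exact ih x hx' y hy' hxy
    · exact ih x hx y hy hxy

open Classical in
theorem accL_cons_card_aux {α : Type} (blk : α → α → Prop) (hr : ∀ x, blk x x)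
    (X : Finset α) (e : α) (l : List α) :
    ((accL blk (e :: l)).filter (fun x => x ∈ X)).card =
      ((accL blk l).filter (fun x => x ∈ X)).card + if e ∈ unbL blk X l then 1 else 0 := by
  have hu : e ∈ unbL blk X l ↔ e ∈ X ∧ ∀ e' ∈ l, ¬ blk e e' := by simp [unbL]
  rw [accL]
  by_cases h : ∀ e' ∈ l, ¬ blk e e'
  · have hn : e ∉ accL blk l := fun he => h e (accL_sub blk l e he) (hr e)
    rw [if_pos h, Finset.filter_insert]
    by_cases hX : e ∈ X
    · rw [if_pos hX, if_pos (hu.2 ⟨hX, h⟩), Finset.card_insert_of_notMem]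
      intro hh; exact hn (Finset.mem_filter.mp hh).1
    · rw [if_neg hX, if_neg (fun hh => hX (hu.1 hh).1)]; rfl
  · rw [if_neg h, if_neg (fun hh => h (hu.1 hh).2)]; rfl

open Classical in
theorem accL_cons_card {α : Type} [DecidableEq α] (blk : α → α → Prop) (hr : ∀ x, blk x x)
    (X : Finset α) (e : α) (l : List α) :
    ((accL blk (e :: l)).filter (fun x => x ∈ X)).card =
      ((accL blk l).filter (fun x => x ∈ X)).card + if e ∈ unbL blk X l then 1 else 0 := by
  convert accL_cons_card_aux blk hr X e l

theorem unbL_cons_le {α : Type} (blk : α → α → Prop) (X : Finset α) (e : α) (l : List α) :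
    (unbL blk X (e :: l)).card ≤ (unbL blk X l).card := by
  apply Finset.card_le_card
  intro x hx
  simp only [unbL, Finset.mem_filter] at hx ⊢
  exact ⟨hx.1, fun e' he' => hx.2 e' (List.mem_cons_of_mem _ he')⟩

open Classical in
/-- Exponential moment bound for the lower tail. -/
theorem sum_lower {α : Type} [Fintype α] [DecidableEq α] [Nonempty α] (blk : α → α → Prop) (hr : ∀ x, blk x x)
    (X : Finset α) (M : ℕ) :
    ∑ ω : Fin M → α, ((1 / 2 : ℝ) ^ ((accL blk (List.ofFn ω)).filter (fun x => x ∈ X)).card *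
      Real.exp (M * ((unbL blk X (List.ofFn ω)).card : ℝ) / (2 * Fintype.card α)))
      ≤ (Fintype.card α : ℝ) ^ M := by
  have hN : (0 : ℝ) < Fintype.card α := by exact_mod_cast Fintype.card_pos
  induction M with
  | zero => simp [accL]
  | succ M ih =>
    rw [← (Fin.consEquiv (fun _ => α)).sum_comp, Fintype.sum_prod_type, Finset.sum_comm]
    have key : ∀ ω : Fin M → α, ∑ e : α,
        ((1 / 2 : ℝ) ^ ((accL blk (List.ofFn ((Fin.consEquiv (fun _ => α)) (e, ω)))).filter
            (fun x => x ∈ X)).card *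
          Real.exp (((M + 1 : ℕ) : ℝ) * ((unbL blk X (List.ofFn
            ((Fin.consEquiv (fun _ => α)) (e, ω)))).card : ℝ) / (2 * Fintype.card α)))
        ≤ (Fintype.card α : ℝ) *
        ((1 / 2 : ℝ) ^ ((accL blk (List.ofFn ω)).filter (fun x => x ∈ X)).card *
      Real.exp (M * ((unbL blk X (List.ofFn ω)).card : ℝ) / (2 * Fintype.card α))) := by
      intro ω
      have hl : ∀ e, List.ofFn ((Fin.consEquiv (fun _ => α)) (e, ω)) = e :: List.ofFn ω := by
        intro e
        simp [Fin.consEquiv, List.ofFn_succ]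
      simp only [hl]
      set l := List.ofFn ω
      set a := ((accL blk l).filter (fun x => x ∈ X)).card with ha
      set U := (unbL blk X l).card with hU
      set N : ℝ := (Fintype.card α : ℝ) with hNdef
      have h1 : ∀ e : α, ((1 / 2 : ℝ) ^ ((accL blk (e :: l)).filter (fun x => x ∈ X)).card *
          Real.exp (((M + 1 : ℕ) : ℝ) * ((unbL blk X (e :: l)).card : ℝ) / (2 * N))) ≤
          ((1 / 2 : ℝ) ^ a * Real.exp (((M + 1 : ℕ) : ℝ) * (U : ℝ) / (2 * N))) *
            (1 - (if e ∈ unbL blk X l then (1 / 2 : ℝ) else 0)) := by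
        intro e
        rw [accL_cons_card blk hr, pow_add]
        have h2 : Real.exp (((M + 1 : ℕ) : ℝ) * ((unbL blk X (e :: l)).card : ℝ) / (2 * N)) ≤
            Real.exp (((M + 1 : ℕ) : ℝ) * (U : ℝ) / (2 * N)) := by
          apply Real.exp_le_exp.mpr
          have : ((unbL blk X (e :: l)).card : ℝ) ≤ U := by exact_mod_cast unbL_cons_le blk X e l
          gcongr
        have h3 : (1 / 2 : ℝ) ^ (if e ∈ unbL blk X l then 1 else 0) =
            (1 - (if e ∈ unbL blk X l then (1 / 2 : ℝ) else 0)) := by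
          split_ifs <;> norm_num
        rw [h3]
        have h4 : (0 : ℝ) ≤ (1 - (if e ∈ unbL blk X l then (1 / 2 : ℝ) else 0)) := by
          split_ifs <;> norm_num
        calc _ = (1 / 2 : ℝ) ^ a * Real.exp (((M + 1 : ℕ) : ℝ) * ((unbL blk X (e :: l)).card : ℝ) / (2 * N)) * (1 - (if e ∈ unbL blk X l then (1 / 2 : ℝ) else 0)) := by ring
          _ ≤ _ := by gcongr
      refine (Finset.sum_le_sum (fun e _ => h1 e)).trans ?_
      rw [← Finset.mul_sum, Finset.sum_sub_distrib]
      have h5 : ∑ e : α, (if e ∈ unbL blk X l then (1 / 2 : ℝ) else 0) = U / 2 := by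
        rw [Finset.sum_ite_mem]
        simp [hU]; ring
      rw [h5]
      have h6 : (∑ _e : α, (1 : ℝ)) = N := by simp [hNdef]
      rw [h6]
      have h7 : N - U / 2 ≤ N * Real.exp (-((U : ℝ) / (2 * N))) := by
        have := Real.add_one_le_exp (-((U : ℝ) / (2 * N)))
        have h8 : N * (-((U : ℝ) / (2 * N)) + 1) = N - U / 2 := by field_simp; ring
        rw [← h8]; gcongr
      have h9 : Real.exp (((M + 1 : ℕ) : ℝ) * (U : ℝ) / (2 * N)) * Real.exp (-((U : ℝ) / (2 * N)))
          = Real.exp (M * (U : ℝ) / (2 * N)) := by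
        rw [← Real.exp_add]; congr 1; push_cast; ring
      calc _ ≤ (1 / 2 : ℝ) ^ a * Real.exp (((M + 1 : ℕ) : ℝ) * (U : ℝ) / (2 * N)) *
            (N * Real.exp (-((U : ℝ) / (2 * N)))) := by gcongr
        _ = N * ((1 / 2 : ℝ) ^ a * (Real.exp (((M + 1 : ℕ) : ℝ) * (U : ℝ) / (2 * N)) *
            Real.exp (-((U : ℝ) / (2 * N))))) := by ring
        _ = _ := by rw [h9]
    refine (Finset.sum_le_sum (fun ω _ => key ω)).trans ?_
    rw [← Finset.mul_sum, pow_succ']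
    gcongr

open Classical in
/-- Exponential moment bound for the upper tail. -/
theorem sum_upper {α : Type} [Fintype α] [DecidableEq α] [Nonempty α] (X : Finset α) (M : ℕ) :
    ∑ ω : Fin M → α, (2 : ℝ) ^ (Finset.univ.filter (fun i => ω i ∈ X)).card
      ≤ (Fintype.card α : ℝ) ^ M * Real.exp (M * ((X.card : ℝ) / Fintype.card α)) := by
  have hN : (0 : ℝ) < Fintype.card α := by exact_mod_cast Fintype.card_pos
  have h1 : ∀ ω : Fin M → α, (2 : ℝ) ^ (Finset.univ.filter (fun i => ω i ∈ X)).card =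
      ∏ i, (if ω i ∈ X then (2 : ℝ) else 1) := by
    intro ω
    rw [Finset.prod_ite]; simp
  simp only [h1]
  rw [← Fintype.sum_pow (fun a => if a ∈ X then (2 : ℝ) else 1)]
  have h2 : ∑ a : α, (if a ∈ X then (2 : ℝ) else 1) = Fintype.card α + X.card := by
    have : ∀ a : α, (if a ∈ X then (2 : ℝ) else 1) = 1 + (if a ∈ X then (1 : ℝ) else 0) := by
      intro a; split_ifs <;> norm_num
    simp only [this, Finset.sum_add_distrib, Finset.sum_ite_mem]
    simp
  rw [h2, Real.exp_nat_mul, ← mul_pow]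
  have h3 := Real.add_one_le_exp ((X.card : ℝ) / Fintype.card α)
  have h4 : (Fintype.card α : ℝ) + X.card = Fintype.card α * ((X.card : ℝ) / Fintype.card α + 1) := by
    field_simp; ring
  rw [h4]
  gcongr

/-- Averaging: a nonnegative total whose mean is below one has a good point. -/
theorem exists_good {α ι : Type} [Fintype α] [Nonempty α] (M : ℕ) (s : Finset ι)
    (Φ : ι → (Fin M → α) → ℝ) (h0 : ∀ i ω, 0 ≤ Φ i ω)
    (h : ∑ i ∈ s, ∑ ω, Φ i ω < (Fintype.card α : ℝ) ^ M) :
    ∃ ω, ∀ i ∈ s, Φ i ω < 1 := by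
  rw [Finset.sum_comm] at h
  have h1 : (Fintype.card α : ℝ) ^ M = ∑ _ω : Fin M → α, (1 : ℝ) := by simp
  rw [h1] at h
  obtain ⟨ω, _, hω⟩ := Finset.exists_lt_of_sum_lt h
  exact ⟨ω, fun i hi => (Finset.single_le_sum (f := fun i => Φ i ω) (fun j _ => h0 j ω) hi).trans_lt hω⟩

/-- Triples of `{1,…,k}`. -/
abbrev Tr (k : ℕ) : Type := {e : Finset ℕ // e ∈ (Finset.Icc 1 k).powersetCard 3}

/-- Conflict relation: sharing at least two vertices. -/
def cfl (k : ℕ) (x y : Tr k) : Prop := 2 ≤ (x.1 ∩ y.1).card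

open Classical in
/-- Triples containing `v`. -/
noncomputable def atV (k v : ℕ) : Finset (Tr k) := Finset.univ.filter (fun e => v ∈ e.1)

open Classical in
/-- Triples with at least two vertices in `T`. -/
noncomputable def atT (k : ℕ) (T : Finset ℕ) : Finset (Tr k) :=
  Finset.univ.filter (fun e => 2 ≤ (e.1 ∩ T).card)

theorem card_Tr (k : ℕ) : Fintype.card (Tr k) = k.choose 3 := by
  rw [Fintype.card_coe, Finset.card_powersetCard]; simp

theorem card_Tr_real (k : ℕ) (hk : 3 ≤ k) :
    (Fintype.card (Tr k) : ℝ) = k * (k - 1) * (k - 2) / 6 := by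
  rw [card_Tr]
  obtain ⟨n, rfl⟩ : ∃ n, k = n + 3 := ⟨k - 3, by omega⟩
  have h := Nat.add_one_mul_choose_eq (n + 2) 2
  have h2 := Nat.choose_two_right (n + 2)
  have h3 := Nat.cast_choose_two ℝ (n + 2)
  have h' : ((n + 2 + 1 : ℕ) : ℝ) * ((n + 2).choose 2 : ℕ) = ((n + 2 + 1).choose (2 + 1) : ℕ) * ((2 + 1 : ℕ) : ℝ) := by
    exact_mod_cast h
  rw [h3] at h'
  have e : n + 3 = n + 2 + 1 := rfl
  rw [e]
  push_cast at h' ⊢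
  linarith

theorem card_atV (k v : ℕ) (hk : 3 ≤ k) (hv : v ∈ Finset.Icc 1 k) :
    ((atV k v).card : ℝ) / Fintype.card (Tr k) ≤ 3 / k := by
  have h1 : (atV k v).card ≤ (k - 1).choose 2 := by
    have : (atV k v).card ≤ (((Finset.Icc 1 k).erase v).powersetCard 2).card := by
      apply Finset.card_le_card_of_injOn (fun e => e.1.erase v)
      · intro e he
        simp only [atV, Finset.coe_filter, Finset.mem_univ, true_and, Set.mem_ofPred_eq] at he
        have h2 := Finset.mem_powersetCard.mp e.2
        simp only [Finset.mem_coe, Finset.mem_powersetCard]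
        exact ⟨Finset.erase_subset_erase v h2.1, by rw [Finset.card_erase_of_mem he, h2.2]⟩
      · intro e he f hf hef
        simp only [atV, Finset.coe_filter, Finset.mem_univ, true_and, Set.mem_ofPred_eq] at he hf
        apply Subtype.ext
        rw [← Finset.insert_erase he, ← Finset.insert_erase hf]
        simp only at hef
        rw [hef]
    rw [Finset.card_powersetCard, Finset.card_erase_of_mem hv] at this
    simpa using this
  have h2 : ((atV k v).card : ℝ) ≤ (k - 1) * (k - 2) / 2 := by
    have h3 : ((atV k v).card : ℝ) ≤ ((k - 1).choose 2 : ℕ) := by exact_mod_cast h1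
    rw [Nat.cast_choose_two, Nat.cast_sub (by omega)] at h3
    push_cast at h3; linarith
  rw [card_Tr_real k hk]
  have hk' : (3 : ℝ) ≤ k := by exact_mod_cast hk
  have : (0 : ℝ) < (k - 1) * (k - 2) := mul_pos (by linarith) (by linarith)
  rw [div_le_div_iff₀ (by have := mul_pos (show (0:ℝ) < k by linarith) this; linarith) (by linarith)]
  nlinarith

theorem card_atT (k : ℕ) (T : Finset ℕ) (hk : 3 ≤ k) (hT : T ⊆ Finset.Icc 1 k) :
    ((atT k T).card : ℝ) / Fintype.card (Tr k) ≤ 3 * (T.card : ℝ) ^ 2 / k ^ 2 := by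
  have h1 : (atT k T).card ≤ T.card.choose 2 * (k - 2) := by
    have h0 : (atT k T).card = ((atT k T).image Subtype.val).card :=
      (Finset.card_image_of_injective _ Subtype.val_injective).symm
    have hsub : (atT k T).image Subtype.val ⊆ (T.powersetCard 2).biUnion
        (fun P => ((Finset.Icc 1 k) \ P).image (fun x => insert x P)) := by
      intro e he
      obtain ⟨e', he', rfl⟩ := Finset.mem_image.mp he
      simp only [atT, Finset.mem_filter, Finset.mem_univ, true_and] at he'
      obtain ⟨P, hP, hPc⟩ := Finset.exists_subset_card_eq he'
      have h2 := Finset.mem_powersetCard.mp e'.2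
      have hPe : P ⊆ e'.1 := hP.trans Finset.inter_subset_left
      have h3 : (e'.1 \ P).card = 1 := by
        rw [Finset.card_sdiff_of_subset hPe]; omega
      obtain ⟨x, hx⟩ := Finset.card_eq_one.mp h3
      have hx' : x ∈ e'.1 \ P := by rw [hx]; simp
      rw [Finset.mem_sdiff] at hx'
      simp only [Finset.mem_biUnion, Finset.mem_powersetCard, Finset.mem_image, Finset.mem_sdiff]
      refine ⟨P, ⟨hP.trans Finset.inter_subset_right, hPc⟩, x, ⟨h2.1 hx'.1, hx'.2⟩, ?_⟩
      rw [← Finset.sdiff_union_of_subset hPe, hx]; rfl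
    rw [h0]
    refine (Finset.card_le_card hsub).trans ?_
    refine (Finset.card_biUnion_le_card_mul _ _ (k - 2) ?_).trans ?_
    · intro P hP
      refine Finset.card_image_le.trans ?_
      have h2 := Finset.mem_powersetCard.mp hP
      rw [Finset.card_sdiff_of_subset (h2.1.trans hT), h2.2]; simp
    · rw [Finset.card_powersetCard]
  have ht : (T.card : ℝ) ≤ k := by
    have := Finset.card_le_card hT
    simp at this; exact_mod_cast this
  set t : ℝ := (T.card : ℝ) with htd
  have ht0 : 0 ≤ t := by positivity
  have h2 : ((atT k T).card : ℝ) ≤ t * (t - 1) / 2 * (k - 2) := by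
    have h3 : ((atT k T).card : ℝ) ≤ (T.card.choose 2 : ℕ) * ((k - 2 : ℕ) : ℝ) := by exact_mod_cast h1
    rw [Nat.cast_choose_two, Nat.cast_sub (by omega)] at h3
    push_cast at h3; linarith
  rw [card_Tr_real k hk]
  have hk' : (3 : ℝ) ≤ k := by exact_mod_cast hk
  have h4 : (0 : ℝ) < (k - 1) * (k - 2) := mul_pos (by linarith) (by linarith)
  rw [div_le_div_iff₀ (by have := mul_pos (show (0:ℝ) < k by linarith) h4; linarith) (by positivity)]
  have h5 : t * (t - 1) * k ≤ t ^ 2 * (k - 1) := by nlinarith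
  calc ((atT k T).card : ℝ) * k ^ 2 ≤ t * (t - 1) / 2 * (k - 2) * k ^ 2 := by gcongr
    _ = (t * (t - 1) * k) * ((k - 2) * k / 2) := by ring
    _ ≤ (t ^ 2 * (k - 1)) * ((k - 2) * k / 2) := by
        have : (0:ℝ) ≤ (k - 2) * k / 2 := by
          have := mul_nonneg (show (0:ℝ) ≤ k - 2 by linarith) (show (0:ℝ) ≤ k by linarith)
          linarith
        gcongr
    _ = _ := by ring

/-- number of vertices not coloured by the last colour -/
def supN (k : ℕ) (g : ↥(Finset.Icc 1 k) → Fin (k + 2)) : ℕ :=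
  (Finset.univ.filter (fun v => g v ≠ Fin.last (k + 1))).card

theorem kraft_g (k : ℕ) :
    ∑ g : ↥(Finset.Icc 1 k) → Fin (k + 2), ((1 : ℝ) / (k + 2) ^ 2) ^ supN k g ≤ Real.exp 1 := by
  have h1 : ∀ g : ↥(Finset.Icc 1 k) → Fin (k + 2), ((1 : ℝ) / (k + 2) ^ 2) ^ supN k g =
      ∏ v, (if g v ≠ Fin.last (k + 1) then (1 : ℝ) / (k + 2) ^ 2 else 1) := by
    intro g
    rw [Finset.prod_ite]; simp [supN]
  simp only [h1]
  have h2 := Finset.prod_univ_sum (fun _ : ↥(Finset.Icc 1 k) => (Finset.univ : Finset (Fin (k+2))))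
    (fun _ c => (if c ≠ Fin.last (k + 1) then (1 : ℝ) / (k + 2) ^ 2 else 1))
  rw [Fintype.piFinset_univ] at h2
  rw [← h2, Finset.prod_const, Fin.sum_univ_castSucc]
  have h3 : ∀ i : Fin (k+1), i.castSucc ≠ Fin.last (k+1) := fun i => (Fin.castSucc_lt_last i).ne
  simp only [ne_eq, h3, not_false_eq_true, if_true, not_true_eq_false, if_false, Finset.sum_const,
    Finset.card_univ, Fintype.card_fin, Fintype.card_coe, Nat.card_Icc, Nat.add_sub_cancel,
    nsmul_eq_mul]
  have hk : (0 : ℝ) ≤ k := by positivity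
  by_cases hk0 : k = 0
  · subst hk0; simp
  have hkp : (0 : ℝ) < k := by positivity
  have h4 : ((k + 1 : ℕ) : ℝ) * (1 / (k + 2) ^ 2) + 1 ≤ Real.exp (1 / k) := by
    refine le_trans ?_ (Real.add_one_le_exp _)
    have : ((k + 1 : ℕ) : ℝ) * (1 / (k + 2) ^ 2) ≤ 1 / k := by
      rw [mul_one_div, div_le_div_iff₀ (by positivity) hkp]
      push_cast; nlinarith
    linarith
  calc _ ≤ (Real.exp (1 / k)) ^ k := by gcongr
    _ = Real.exp 1 := by rw [← Real.exp_nat_mul]; congr 1; field_simp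

theorem kraft_T (k : ℕ) :
    ∑ T ∈ (Finset.Icc 1 k).powerset, ((1 : ℝ) / (k + 1)) ^ T.card ≤ Real.exp 1 := by
  have h := Finset.sum_pow_mul_eq_add_pow ((1 : ℝ) / (k + 1)) 1 (Finset.Icc 1 k)
  simp only [one_pow, mul_one, Nat.card_Icc, Nat.add_sub_cancel] at h
  rw [h]
  by_cases hk0 : k = 0
  · subst hk0; simp
  have hkp : (0 : ℝ) < k := by positivity
  have h4 : (1 : ℝ) / (k + 1) + 1 ≤ Real.exp (1 / k) := by
    refine le_trans ?_ (Real.add_one_le_exp _)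
    have : (1 : ℝ) / (k + 1) ≤ 1 / k := by gcongr; linarith
    linarith
  calc _ ≤ (Real.exp (1 / k)) ^ k := by gcongr
    _ = Real.exp 1 := by rw [← Real.exp_nat_mul]; congr 1; field_simp

theorem nonempty_Tr (k : ℕ) (hk : 3 ≤ k) : Nonempty (Tr k) := by
  rw [← Fintype.card_pos_iff, card_Tr]; exact Nat.choose_pos hk

open Classical in
theorem mean_V (k M v : ℕ) (hk : 3 ≤ k) (hv : v ∈ Finset.Icc 1 k) :
    ∑ ω : Fin M → Tr k, (2 : ℝ) ^ (Finset.univ.filter (fun i => ω i ∈ atV k v)).card *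
        (4 * (k : ℝ) * Real.exp (3 * M / k))⁻¹ ≤ (Fintype.card (Tr k) : ℝ) ^ M / (4 * k) := by
  have hk0 : (0 : ℝ) < k := by have : 0 < k := by omega
                               exact_mod_cast this
  have := nonempty_Tr k hk
  rw [← Finset.sum_mul]
  have h1 := sum_upper (atV k v) M
  have h0 := card_atV k v hk hv
  have h2 : (M : ℝ) * (((atV k v).card : ℝ) / Fintype.card (Tr k)) ≤ 3 * M / k := by
    calc _ ≤ (M : ℝ) * (3 / k) := mul_le_mul_of_nonneg_left h0 (by positivity)
      _ = _ := by ring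
  have h3 := Real.exp_le_exp.mpr h2
  have h4 := h1.trans (mul_le_mul_of_nonneg_left h3 (by positivity))
  have hy := Real.exp_pos (3 * (M : ℝ) / k)
  generalize Real.exp (3 * (M : ℝ) / k) = y at *
  calc _ ≤ _ := mul_le_mul_of_nonneg_right h4 (by positivity)
    _ = _ := by field_simp

open Classical in
theorem mean_T (k M : ℕ) (T : Finset ℕ) (hk : 3 ≤ k) (hT : T ⊆ Finset.Icc 1 k) :
    ∑ ω : Fin M → Tr k, (2 : ℝ) ^ (Finset.univ.filter (fun i => ω i ∈ atT k T)).card *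
        (12 * ((k : ℝ) + 1) ^ T.card * Real.exp (3 * M * (T.card : ℝ) ^ 2 / k ^ 2))⁻¹ ≤
      (Fintype.card (Tr k) : ℝ) ^ M / 12 * ((1 : ℝ) / (k + 1)) ^ T.card := by
  have hk0 : (0 : ℝ) < k := by have : 0 < k := by omega
                               exact_mod_cast this
  have := nonempty_Tr k hk
  rw [← Finset.sum_mul]
  have h1 := sum_upper (atT k T) M
  have h0 := card_atT k T hk hT
  have h2 : (M : ℝ) * (((atT k T).card : ℝ) / Fintype.card (Tr k)) ≤
      3 * M * (T.card : ℝ) ^ 2 / k ^ 2 := by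
    calc _ ≤ (M : ℝ) * (3 * (T.card : ℝ) ^ 2 / k ^ 2) :=
          mul_le_mul_of_nonneg_left h0 (by positivity)
      _ = _ := by ring
  have h3 := Real.exp_le_exp.mpr h2
  have h4 := h1.trans (mul_le_mul_of_nonneg_left h3 (by positivity))
  have hy := Real.exp_pos (3 * M * (T.card : ℝ) ^ 2 / k ^ 2)
  generalize Real.exp (3 * M * (T.card : ℝ) ^ 2 / k ^ 2) = y at *
  rw [one_div, inv_pow]
  calc _ ≤ _ := mul_le_mul_of_nonneg_right h4 (by positivity)
    _ = _ := by field_simp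

open Classical in
theorem exists_omega (k M : ℕ) (hk : 3 ≤ k)
    (X : (↥(Finset.Icc 1 k) → Fin (k + 2)) → Finset (Tr k)) :
    ∃ ω : Fin M → Tr k,
      (∀ v ∈ Finset.Icc 1 k, (2 : ℝ) ^ (Finset.univ.filter (fun i => ω i ∈ atV k v)).card <
        4 * k * Real.exp (3 * M / k)) ∧
      (∀ T ⊆ Finset.Icc 1 k, (2 : ℝ) ^ (Finset.univ.filter (fun i => ω i ∈ atT k T)).card <
        12 * (k + 1) ^ T.card * Real.exp (3 * M * (T.card : ℝ) ^ 2 / k ^ 2)) ∧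
      (∀ g, Real.exp (M * ((unbL (cfl k) (X g) (List.ofFn ω)).card : ℝ) / (2 * Fintype.card (Tr k)))
        < 12 * ((k + 2) ^ 2) ^ supN k g *
          2 ^ ((accL (cfl k) (List.ofFn ω)).filter (fun x => x ∈ X g)).card) := by
  have hk0 : (0 : ℝ) < k := by have : 0 < k := by omega
                               exact_mod_cast this
  have := nonempty_Tr k hk
  have hr : ∀ x, cfl k x x := by
    intro x
    unfold cfl
    rw [Finset.inter_self, (Finset.mem_powersetCard.mp x.2).2]; norm_num
  have hN : (0 : ℝ) < (Fintype.card (Tr k) : ℝ) ^ M := by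
    have : (0 : ℝ) < Fintype.card (Tr k) := by exact_mod_cast Fintype.card_pos
    positivity
  set NN := (Fintype.card (Tr k) : ℝ) ^ M with hNN
  let Φ : (ℕ ⊕ (Finset ℕ ⊕ (↥(Finset.Icc 1 k) → Fin (k + 2)))) → (Fin M → Tr k) → ℝ := fun i ω =>
    match i with
    | Sum.inl v => (2 : ℝ) ^ (Finset.univ.filter (fun i => ω i ∈ atV k v)).card *
        (4 * (k : ℝ) * Real.exp (3 * M / k))⁻¹
    | Sum.inr (Sum.inl T) => (2 : ℝ) ^ (Finset.univ.filter (fun i => ω i ∈ atT k T)).card *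
        (12 * ((k : ℝ) + 1) ^ T.card * Real.exp (3 * M * (T.card : ℝ) ^ 2 / k ^ 2))⁻¹
    | Sum.inr (Sum.inr g) =>
        ((1 / 2 : ℝ) ^ ((accL (cfl k) (List.ofFn ω)).filter (fun x => x ∈ X g)).card *
          Real.exp (M * ((unbL (cfl k) (X g) (List.ofFn ω)).card : ℝ) /
            (2 * Fintype.card (Tr k)))) * (12 * (((k : ℝ) + 2) ^ 2) ^ supN k g)⁻¹
  have hΦ0 : ∀ i ω, 0 ≤ Φ i ω := by
    rintro (v | T | g) ω <;> simp only [Φ] <;> positivity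
  have hsum : ∑ i ∈ (Finset.Icc 1 k).disjSum ((Finset.Icc 1 k).powerset.disjSum Finset.univ),
      ∑ ω, Φ i ω < NN := by
    rw [Finset.sum_disjSum, Finset.sum_disjSum]
    have e1 : ∑ v ∈ Finset.Icc 1 k, ∑ ω, Φ (Sum.inl v) ω ≤ NN / 4 := by
      have : ∀ v ∈ Finset.Icc 1 k, ∑ ω, Φ (Sum.inl v) ω ≤ NN / (4 * k) := by
        intro v hv
        exact mean_V k M v hk hv
      refine (Finset.sum_le_sum this).trans ?_
      rw [Finset.sum_const, Nat.card_Icc, Nat.add_sub_cancel, nsmul_eq_mul]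
      apply le_of_eq; field_simp
    have e2 : ∑ T ∈ (Finset.Icc 1 k).powerset, ∑ ω, Φ (Sum.inr (Sum.inl T)) ω ≤
        NN / 12 * Real.exp 1 := by
      have : ∀ T ∈ (Finset.Icc 1 k).powerset, ∑ ω, Φ (Sum.inr (Sum.inl T)) ω ≤
          NN / 12 * ((1 : ℝ) / (k + 1)) ^ T.card := by
        intro T hT
        exact mean_T k M T hk (Finset.mem_powerset.mp hT)
      refine (Finset.sum_le_sum this).trans ?_
      rw [← Finset.mul_sum]
      gcongr
      exact kraft_T k
    have e3 : ∑ g, ∑ ω, Φ (Sum.inr (Sum.inr g)) ω ≤ NN / 12 * Real.exp 1 := by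
      have : ∀ g ∈ (Finset.univ : Finset (↥(Finset.Icc 1 k) → Fin (k + 2))),
          ∑ ω, Φ (Sum.inr (Sum.inr g)) ω ≤ NN / 12 * ((1 : ℝ) / (k + 2) ^ 2) ^ supN k g := by
        intro g _
        simp only [Φ]
        rw [← Finset.sum_mul]
        have h1 := sum_lower (cfl k) hr (X g) M
        calc _ ≤ NN * (12 * (((k : ℝ) + 2) ^ 2) ^ supN k g)⁻¹ := by gcongr
          _ = _ := by rw [one_div, inv_pow, mul_inv]; ring
      refine (Finset.sum_le_sum this).trans ?_
      rw [← Finset.mul_sum]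
      gcongr
      exact kraft_g k
    have he := Real.exp_one_lt_d9
    nlinarith
  obtain ⟨ω, hω⟩ := exists_good M _ Φ hΦ0 hsum
  refine ⟨ω, ?_, ?_, ?_⟩
  · intro v hv
    have := hω (Sum.inl v) (by simpa using hv)
    simp only [Φ] at this
    rwa [← div_eq_mul_inv, div_lt_one (by positivity)] at this
  · intro T hT
    have := hω (Sum.inr (Sum.inl T)) (by simpa using hT)
    simp only [Φ] at this
    rwa [← div_eq_mul_inv, div_lt_one (by positivity)] at this
  · intro g
    have := hω (Sum.inr (Sum.inr g)) (by simp)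
    simp only [Φ] at this
    rw [← div_eq_mul_inv, div_lt_one (by positivity), one_div, inv_pow, inv_mul_eq_div,
      div_lt_iff₀ (by positivity)] at this
    exact this

/-- The numerical conditions on `k` used below. -/
def Big (k : ℕ) : Prop :=
  3 ≤ k ∧ 10 ^ 6 ≤ Real.log k ∧ 10 ^ 6 * Real.log k ^ 3 ≤ Real.sqrt k ∧
    10 ^ 6 * Real.log k ≤ (k : ℝ) ^ ((1 : ℝ) / 5)

theorem eventually_big : ∃ k₀ : ℕ, ∀ k : ℕ, k₀ ≤ k → Big k := by
  rw [← Filter.eventually_atTop]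
  have hc : Filter.Tendsto (fun k : ℕ => (k : ℝ)) Filter.atTop Filter.atTop :=
    tendsto_natCast_atTop_atTop
  have h1 : ∀ᶠ k : ℕ in Filter.atTop, (10 : ℝ) ^ 6 ≤ Real.log k :=
    (Real.tendsto_log_atTop.comp hc).eventually_ge_atTop _
  have h2 := (isLittleO_log_rpow_rpow_atTop (s := 1 / 2) 3 (by norm_num)).bound
    (show (0 : ℝ) < 1 / 10 ^ 6 by norm_num)
  have h3 := (isLittleO_log_rpow_atTop (r := 1 / 5) (by norm_num)).bound
    (show (0 : ℝ) < 1 / 10 ^ 6 by norm_num)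
  filter_upwards [h1, hc.eventually h2, hc.eventually h3, Filter.eventually_ge_atTop 3]
    with k h1 h2 h3 h4
  have hk : (0 : ℝ) ≤ k := by positivity
  have hL : 0 ≤ Real.log k := by linarith [show (0:ℝ) ≤ 10 ^ 6 by norm_num]
  refine ⟨h4, h1, ?_, ?_⟩
  · rw [Real.norm_of_nonneg (by positivity), Real.norm_of_nonneg (by positivity),
      ← Real.sqrt_eq_rpow] at h2
    have : Real.log k ^ (3 : ℝ) = Real.log k ^ 3 := by norm_cast
    rw [this] at h2
    linarith
  · rw [Real.norm_of_nonneg (by positivity), Real.norm_of_nonneg (by positivity)] at h3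
    linarith

theorem log_le_of_big (k : ℕ) (h : Big k) : Real.log (k + 2) ≤ 2 * Real.log k := by
  have hk : (3 : ℝ) ≤ k := by exact_mod_cast h.1
  rw [← Real.log_rpow (by linarith)]
  apply Real.log_le_log (by linarith)
  have : (k : ℝ) ^ (2 : ℝ) = k ^ 2 := by norm_cast
  rw [this]; nlinarith

/-- Pair covered by a triple of the sequence. -/
def cov {k M : ℕ} (ω : Fin M → Tr k) (b c : ℕ) : Prop := ∃ i, b ∈ (ω i).1 ∧ c ∈ (ω i).1

theorem cov_symm {k M : ℕ} (ω : Fin M → Tr k) (b c : ℕ) (h : cov ω b c) : cov ω c b := by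
  obtain ⟨i, h1, h2⟩ := h; exact ⟨i, h2, h1⟩

open Classical in
theorem cov_deg {k M : ℕ} (ω : Fin M → Tr k) (v : ℕ) (B : Finset ℕ) :
    (B.filter (fun w => w ≠ v ∧ cov ω v w)).card ≤
      (Finset.univ.filter (fun i => ω i ∈ atV k v)).card * 2 := by
  have hsub : B.filter (fun w => w ≠ v ∧ cov ω v w) ⊆
      (Finset.univ.filter (fun i => ω i ∈ atV k v)).biUnion (fun i => (ω i).1.erase v) := by
    intro w hw
    obtain ⟨_, hne, i, h1, h2⟩ := Finset.mem_filter.mp hw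
    simp only [Finset.mem_biUnion, Finset.mem_filter, Finset.mem_univ, true_and, atV,
      Finset.mem_erase]
    exact ⟨i, h1, hne, h2⟩
  refine (Finset.card_le_card hsub).trans (Finset.card_biUnion_le_card_mul _ _ _ ?_)
  intro i hi
  simp only [Finset.mem_filter, Finset.mem_univ, true_and, atV] at hi
  rw [Finset.card_erase_of_mem hi, (Finset.mem_powersetCard.mp (ω i).2).2]

open Classical in
theorem cov_pairs {k M : ℕ} (ω : Fin M → Tr k) (T : Finset ℕ) :
    ((T ×ˢ T).filter (fun p => p.1 ≠ p.2 ∧ cov ω p.1 p.2)).card ≤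
      (Finset.univ.filter (fun i => ω i ∈ atT k T)).card * 6 := by
  have hsub : (T ×ˢ T).filter (fun p => p.1 ≠ p.2 ∧ cov ω p.1 p.2) ⊆
      (Finset.univ.filter (fun i => ω i ∈ atT k T)).biUnion (fun i => (ω i).1.offDiag) := by
    rintro ⟨b, c⟩ hw
    obtain ⟨hT, hne, i, h1, h2⟩ := Finset.mem_filter.mp hw
    rw [Finset.mem_product] at hT
    simp only [Finset.mem_biUnion, Finset.mem_filter, Finset.mem_univ, true_and, atT,
      Finset.mem_offDiag]
    refine ⟨i, ?_, h1, h2, hne⟩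
    apply Finset.one_lt_card.mpr
    exact ⟨b, Finset.mem_inter.mpr ⟨h1, hT.1⟩, c, Finset.mem_inter.mpr ⟨h2, hT.2⟩, hne⟩
  refine (Finset.card_le_card hsub).trans (Finset.card_biUnion_le_card_mul _ _ _ ?_)
  intro i hi
  rw [Finset.offDiag_card, (Finset.mem_powersetCard.mp (ω i).2).2]

/-- Extension of a colouring. -/
def gx (k : ℕ) (g : ↥(Finset.Icc 1 k) → Fin (k + 2)) (v : ℕ) : ℕ :=
  if h : v ∈ Finset.Icc 1 k then (g ⟨v, h⟩ : ℕ) else k + 1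

open Classical in
/-- Triples with one vertex of colour zero and two of distinct proper colours. -/
noncomputable def Xg (k : ℕ) (g : ↥(Finset.Icc 1 k) → Fin (k + 2)) : Finset (Tr k) :=
  Finset.univ.filter (fun e => ∃ a b c, e.1 = {a, b, c} ∧ gx k g a = 0 ∧
    gx k g b ∈ Finset.Icc 1 k ∧ gx k g c ∈ Finset.Icc 1 k ∧ gx k g b ≠ gx k g c)

open Classical in
/-- The colouring attached to `S`, `A` and colours on `A`. -/
noncomputable def mkg (k : ℕ) (S A : Finset ℕ) (col : ℕ → ℕ) (v : ↥(Finset.Icc 1 k)) :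
    Fin (k + 2) :=
  if v.1 ∈ S then 0 else if v.1 ∈ A then Fin.ofNat (k + 2) (col v.1) else Fin.last (k + 1)

theorem gx_S {k : ℕ} {S A : Finset ℕ} {col : ℕ → ℕ} (hS : S ⊆ Finset.Icc 1 k) {v : ℕ}
    (hv : v ∈ S) : gx k (mkg k S A col) v = 0 := by
  simp [gx, hS hv, mkg, hv]

theorem gx_A {k : ℕ} {S A : Finset ℕ} {col : ℕ → ℕ} (hA : A ⊆ Finset.Icc 1 k)
    (hd : Disjoint S A) (hc : ∀ v ∈ A, col v ∈ Finset.Icc 1 k) {v : ℕ}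
    (hv : v ∈ A) : gx k (mkg k S A col) v = col v := by
  have h1 : v ∉ S := fun h => Finset.disjoint_left.mp hd h hv
  have h2 := Finset.mem_Icc.mp (hc v hv)
  simp only [gx, hA hv, mkg, hv, h1, dite_true, if_true, if_false, Fin.ofNat]
  exact Nat.mod_eq_of_lt (by omega)

theorem gx_cases {k : ℕ} {S A : Finset ℕ} {col : ℕ → ℕ} (v : ℕ) :
    v ∈ S ∨ v ∈ A ∨ gx k (mkg k S A col) v = k + 1 := by
  by_cases h1 : v ∈ S
  · exact Or.inl h1
  by_cases h2 : v ∈ A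
  · exact Or.inr (Or.inl h2)
  right; right
  simp only [gx, mkg, h1, h2, if_false]
  split_ifs <;> simp

theorem supN_mkg (k : ℕ) (S A : Finset ℕ) (col : ℕ → ℕ) :
    supN k (mkg k S A col) ≤ S.card + A.card := by
  refine le_trans ?_ (Finset.card_union_le S A)
  unfold supN
  apply Finset.card_le_card_of_injOn (fun v => v.1)
  · intro v hv
    simp only [Finset.coe_filter, Finset.mem_univ, true_and, Set.mem_ofPred_eq] at hv
    rw [Finset.mem_coe, Finset.mem_union]
    by_contra h
    push Not at h
    exact hv (by simp [mkg, h.1, h.2])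
  · intro a _ b _ h; exact Subtype.ext h

theorem mem_Xg {k : ℕ} {S A : Finset ℕ} {col : ℕ → ℕ} (hS : S ⊆ Finset.Icc 1 k)
    (hA : A ⊆ Finset.Icc 1 k)
    (hd : Disjoint S A) (hc : ∀ v ∈ A, col v ∈ Finset.Icc 1 k) (e : Tr k) :
    e ∈ Xg k (mkg k S A col) ↔
      ∃ s ∈ S, ∃ b ∈ A, ∃ c ∈ A, col b ≠ col c ∧ e.1 = {s, b, c} := by
  simp only [Xg, Finset.mem_filter, Finset.mem_univ, true_and]
  constructor
  · rintro ⟨a, b, c, he, ha, hb, hc', hbc⟩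
    have hAof : ∀ x, gx k (mkg k S A col) x ∈ Finset.Icc 1 k → x ∈ A := by
      intro x hx
      rw [Finset.mem_Icc] at hx
      rcases gx_cases (k := k) (S := S) (A := A) (col := col) x with h | h | h
      · rw [gx_S hS h] at hx; omega
      · exact h
      · omega
    have hbA := hAof b hb
    have hcA := hAof c hc'
    have haS : a ∈ S := by
      rcases gx_cases (k := k) (S := S) (A := A) (col := col) a with h | h | h
      · exact h
      · rw [gx_A hA hd hc h] at ha
        have := Finset.mem_Icc.mp (hc a h); omega
      · omega
    rw [gx_A hA hd hc hbA, gx_A hA hd hc hcA] at hbc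
    exact ⟨a, haS, b, hbA, c, hcA, hbc, he⟩
  · rintro ⟨a, ha, b, hb, c, hc', hbc, he⟩
    refine ⟨a, b, c, he, gx_S hS ha, ?_, ?_, ?_⟩
    · rw [gx_A hA hd hc hb]; exact hc b hb
    · rw [gx_A hA hd hc hc']; exact hc c hc'
    · rw [gx_A hA hd hc hb, gx_A hA hd hc hc']; exact hbc

open Classical in
/-- Lower bound on the number of unblocked triples. -/
theorem unb_lower {k M : ℕ} (ω : Fin M → Tr k) {S A : Finset ℕ} {col : ℕ → ℕ}
    (hS : S ⊆ Finset.Icc 1 k) (hA : A ⊆ Finset.Icc 1 k)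
    (hd : Disjoint S A) (hc : ∀ v ∈ A, col v ∈ Finset.Icc 1 k) :
    S.card * ((A ×ˢ A).filter (fun p => col p.1 ≠ col p.2)).card ≤
      2 * (unbL (cfl k) (Xg k (mkg k S A col)) (List.ofFn ω)).card +
      ((S ×ˢ (A ×ˢ A)).filter (fun p => p.2.1 ≠ p.2.2 ∧
        (cov ω p.1 p.2.1 ∨ cov ω p.1 p.2.2 ∨ cov ω p.2.1 p.2.2))).card := by
  set Y := (S ×ˢ (A ×ˢ A)).filter (fun p => col p.2.1 ≠ col p.2.2 ∧
        ¬ (cov ω p.1 p.2.1 ∨ cov ω p.1 p.2.2 ∨ cov ω p.2.1 p.2.2)) with hY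
  have hne : ∀ s ∈ S, ∀ b ∈ A, s ≠ b := fun s hs b hb h =>
    Finset.disjoint_left.mp hd hs (h ▸ hb)
  have h1 : Y.card ≤ 2 * (unbL (cfl k) (Xg k (mkg k S A col)) (List.ofFn ω)).card := by
    rw [← Finset.card_image_of_injective (unbL (cfl k) (Xg k (mkg k S A col)) (List.ofFn ω))
      Subtype.val_injective]
    apply Finset.card_le_mul_card_image_of_maps_to (f := fun p => ({p.1, p.2.1, p.2.2} : Finset ℕ))
    · rintro ⟨s, b, c⟩ hp
      simp only [hY, Finset.mem_filter, Finset.mem_product] at hp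
      obtain ⟨⟨hs, hb, hc'⟩, hbc, hcov⟩ := hp
      push Not at hcov
      have hbc' : b ≠ c := fun h => hbc (by rw [h])
      have hsb := hne s hs b hb
      have hsc := hne s hs c hc'
      have hT : ({s, b, c} : Finset ℕ) ∈ (Finset.Icc 1 k).powersetCard 3 := by
        rw [Finset.mem_powersetCard]
        refine ⟨?_, Finset.card_eq_three.mpr ⟨s, b, c, hsb, hsc, hbc', rfl⟩⟩
        intro x hx
        simp only [Finset.mem_insert, Finset.mem_singleton] at hx
        rcases hx with rfl | rfl | rfl
        exacts [hS hs, hA hb, hA hc']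
      rw [Finset.mem_image]
      refine ⟨⟨_, hT⟩, ?_, rfl⟩
      rw [mem_unbL]
      refine ⟨(mem_Xg hS hA hd hc _).mpr ⟨s, hs, b, hb, c, hc', hbc, rfl⟩, ?_⟩
      intro e he hcf
      obtain ⟨i, rfl⟩ := (List.mem_ofFn).mp he
      obtain ⟨x, hx, y, hy, hxy⟩ := Finset.one_lt_card.mp hcf
      rw [Finset.mem_inter] at hx hy
      have hxc := hx.1
      have hyc := hy.1
      have hxy' : cov ω x y := ⟨i, hx.2, hy.2⟩
      have hyx' : cov ω y x := ⟨i, hy.2, hx.2⟩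
      simp only [Finset.mem_insert, Finset.mem_singleton] at hxc hyc
      obtain ⟨q1, q2, q3⟩ := hcov
      rcases hxc with rfl | rfl | rfl <;> rcases hyc with rfl | rfl | rfl <;>
        first
          | exact hxy rfl
          | exact q1 hxy'
          | exact q2 hxy'
          | exact q3 hxy'
          | exact q1 hyx'
          | exact q2 hyx'
          | exact q3 hyx'
    · intro e _
      by_cases hem : (Y.filter (fun p => ({p.1, p.2.1, p.2.2} : Finset ℕ) = e)).Nonempty
      · obtain ⟨⟨s, b, c⟩, hp⟩ := hem
        simp only [hY, Finset.mem_filter, Finset.mem_product] at hp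
        obtain ⟨⟨⟨hs, hb, hc'⟩, hbc, -⟩, he⟩ := hp
        have : Y.filter (fun p => ({p.1, p.2.1, p.2.2} : Finset ℕ) = e) ⊆
            {(s, b, c), (s, c, b)} := by
          rintro ⟨s', b', c'⟩ hp'
          simp only [hY, Finset.mem_filter, Finset.mem_product] at hp'
          obtain ⟨⟨⟨hs', hb', hc''⟩, hbc', -⟩, he'⟩ := hp'
          rw [← he] at he'
          have m1 : s' ∈ ({s, b, c} : Finset ℕ) := by rw [← he']; simp
          have m2 : b' ∈ ({s, b, c} : Finset ℕ) := by rw [← he']; simp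
          have m3 : c' ∈ ({s, b, c} : Finset ℕ) := by rw [← he']; simp
          simp only [Finset.mem_insert, Finset.mem_singleton] at m1 m2 m3
          have z1 := hne s' hs' b hb
          have z2 := hne s' hs' c hc'
          have z3 := hne s hs b' hb'
          have z4 := hne s hs c' hc''
          have z5 : b' ≠ c' := fun h => hbc' (by rw [h])
          simp only [Finset.mem_insert, Finset.mem_singleton, Prod.mk.injEq]
          grind
        exact (Finset.card_le_card this).trans Finset.card_le_two
      · rw [Finset.not_nonempty_iff_eq_empty] at hem
        rw [hem]; simp
  rw [← Finset.card_product]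
  refine le_trans ?_ (Nat.add_le_add_right h1 _)
  refine le_trans (Finset.card_le_card ?_) (Finset.card_union_le _ _)
  rintro ⟨s, b, c⟩ hp
  simp only [Finset.mem_product, Finset.mem_filter] at hp
  simp only [hY, Finset.mem_union, Finset.mem_filter, Finset.mem_product]
  have : b ≠ c := fun h => hp.2.2 (by rw [h])
  by_cases h : cov ω s b ∨ cov ω s c ∨ cov ω b c
  · exact Or.inr ⟨⟨hp.1, hp.2.1⟩, this, h⟩
  · exact Or.inl ⟨⟨hp.1, hp.2.1⟩, hp.2.2, h⟩

set_option maxHeartbeats 1000000 in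
open Classical in
/-- The core statement: a linear system together with its covering relation. -/
theorem core (k : ℕ) (hB : Big k) :
    ∃ F : ThreeGraph, F.verts = Finset.Icc 1 k ∧ LinearTG F ∧ ∃ cv : ℕ → ℕ → Prop,
      (∀ b c, cv b c → cv c b) ∧
      (∀ v ∈ Finset.Icc 1 k, ∀ B : Finset ℕ,
        ((B.filter (fun w => w ≠ v ∧ cv v w)).card : ℝ) ≤ k / 50) ∧
      (∀ T ⊆ Finset.Icc 1 k, Real.sqrt k ≤ T.card →
        (((T ×ˢ T).filter (fun p => p.1 ≠ p.2 ∧ cv p.1 p.2)).card : ℝ) ≤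
          6 / 100 * (T.card : ℝ) ^ 2) ∧
      (∀ (S A : Finset ℕ) (col : ℕ → ℕ), S ⊆ Finset.Icc 1 k → A ⊆ Finset.Icc 1 k →
        Disjoint S A → (∀ v ∈ A, col v ∈ Finset.Icc 1 k) →
        3 / (902 * k) * ((S.card : ℝ) * (((A ×ˢ A).filter (fun p => col p.1 ≠ col p.2)).card : ℝ) -
          (((S ×ˢ (A ×ˢ A)).filter (fun p => p.2.1 ≠ p.2.2 ∧
            (cv p.1 p.2.1 ∨ cv p.1 p.2.2 ∨ cv p.2.1 p.2.2))).card : ℝ))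
          - 4 * ((S.card : ℝ) + A.card) * Real.log k - 3 ≤
        ((F.edges.filter (fun e => ∃ s ∈ S, ∃ b ∈ A, ∃ c ∈ A, col b ≠ col c ∧
          e = {s, b, c})).card : ℝ)) := by
  obtain ⟨hk, hL, hR, -⟩ := id hB
  have hlog := log_le_of_big k hB
  have hk3 : (3 : ℝ) ≤ k := by exact_mod_cast hk
  obtain ⟨M, hM⟩ : ∃ M, M = k ^ 2 / 450 := ⟨_, rfl⟩
  obtain ⟨ω, h1, h2, h3⟩ := exists_omega k M hk (Xg k)
  set L := Real.log k with hLd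
  set R := Real.sqrt k with hRd
  have hRR : R * R = k := Real.mul_self_sqrt (by positivity)
  have hL1 : (1 : ℝ) ≤ L := le_trans (by norm_num) hL
  have hL3 : L ≤ L ^ 3 := by nlinarith [sq_nonneg L, mul_nonneg (sub_nonneg.2 hL1) (sub_nonneg.2 hL1)]
  have hRL : 10 ^ 6 * L ≤ R := le_trans (by linarith) hR
  have hR6 : 10 ^ 12 ≤ R := by linarith
  have hMu : (M : ℝ) ≤ (k : ℝ) ^ 2 / 450 := by
    have := @Nat.cast_div_le ℝ _ _ _ (k ^ 2) 450
    rw [hM]; push_cast at this ⊢; exact this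
  have hMl : (k : ℝ) ^ 2 / 451 ≤ (M : ℝ) := by
    have h4 : k ^ 2 < 450 * (M + 1) := by
      have := Nat.lt_mul_div_succ (k ^ 2) (show 0 < 450 by norm_num)
      omega
    have h5 : (k : ℝ) ^ 2 < 450 * (M + 1) := by exact_mod_cast h4
    have : (10 : ℝ) ^ 24 ≤ k := by nlinarith
    nlinarith
  have hl2 := Real.log_two_gt_d9
  have hl2' := Real.log_two_lt_d9
  have hl12 : Real.log 12 ≤ 3 := by
    rw [Real.log_le_iff_le_exp (by norm_num)]
    have h := Real.exp_one_gt_d9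
    have : Real.exp 3 = Real.exp 1 ^ 3 := by rw [← Real.exp_nat_mul]; norm_num
    rw [this]
    calc (12 : ℝ) ≤ 2.7 ^ 3 := by norm_num
      _ ≤ _ := by gcongr; linarith
  have hl4 : Real.log 4 ≤ 2 := by
    have : (4 : ℝ) = 2 ^ 2 := by norm_num
    rw [this, Real.log_pow]; push_cast; linarith
  have hlk1 : Real.log (k + 1) ≤ 2 * L :=
    (Real.log_le_log (by linarith) (by linarith)).trans hlog
  let F : ThreeGraph :=
    { verts := Finset.Icc 1 k
      edges := (accL (cfl k) (List.ofFn ω)).image Subtype.val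
      card_eq := by
        intro e he
        obtain ⟨x, -, rfl⟩ := Finset.mem_image.mp he
        exact (Finset.mem_powersetCard.mp x.2).2
      subset_verts := by
        intro e he
        obtain ⟨x, -, rfl⟩ := Finset.mem_image.mp he
        exact (Finset.mem_powersetCard.mp x.2).1 }
  refine ⟨F, rfl, ?_, cov ω, cov_symm ω, ?_, ?_, ?_⟩
  · intro e₁ he₁ e₂ he₂ hne
    obtain ⟨x, hx, rfl⟩ := Finset.mem_image.mp he₁
    obtain ⟨y, hy, rfl⟩ := Finset.mem_image.mp he₂
    have := accL_indep (cfl k) (fun x y h => by unfold cfl at *; rwa [Finset.inter_comm]) _ x hx y hy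
      (fun h => hne (by rw [h]))
    unfold cfl at this
    omega
  · intro v hv B
    have h4 := h1 v hv
    have h5 := Real.log_lt_log (by positivity) h4
    rw [Real.log_pow, Real.log_mul (by positivity) (by positivity),
      Real.log_mul (by norm_num) (by positivity), Real.log_exp] at h5
    have h6 : 3 * (M : ℝ) / k ≤ k / 150 := by
      rw [div_le_iff₀ (by positivity)]; nlinarith
    have h7 := cov_deg ω v B
    have h8 : ((B.filter (fun w => w ≠ v ∧ cov ω v w)).card : ℝ) ≤
      ((Finset.univ.filter (fun i => ω i ∈ atV k v)).card : ℝ) * 2 := by exact_mod_cast h7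
    set d : ℝ := ((Finset.univ.filter (fun i => ω i ∈ atV k v)).card : ℝ)
    have hd0 : 0 ≤ d := by positivity
    have h9 : d ≤ k / 100 := by
      by_contra hcon
      push Not at hcon
      have : L ≤ k / 10 ^ 6 := by
        rw [le_div_iff₀ (by norm_num)]; nlinarith
      have h10 : (k : ℝ) / 100 * 0.693 ≤ d * Real.log 2 := by
        apply mul_le_mul hcon.le (by linarith) (by norm_num) hd0
      have : (10 : ℝ) ^ 24 ≤ k := by nlinarith
      linarith
    linarith
  · intro T hT hTR
    have h4 := h2 T hT
    have h5 := Real.log_lt_log (by positivity) h4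
    rw [Real.log_pow, Real.log_mul (by positivity) (by positivity),
      Real.log_mul (by norm_num) (by positivity), Real.log_exp, Real.log_pow] at h5
    set t : ℝ := (T.card : ℝ)
    have ht0 : 0 ≤ t := by positivity
    have h6 : 3 * (M : ℝ) * t ^ 2 / k ^ 2 ≤ t ^ 2 / 150 := by
      rw [div_le_iff₀ (by positivity)]; nlinarith [sq_nonneg t]
    have h7 := cov_pairs ω T
    have h8 : (((T ×ˢ T).filter (fun p => p.1 ≠ p.2 ∧ cov ω p.1 p.2)).card : ℝ) ≤
      ((Finset.univ.filter (fun i => ω i ∈ atT k T)).card : ℝ) * 6 := by exact_mod_cast h7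
    set d : ℝ := ((Finset.univ.filter (fun i => ω i ∈ atT k T)).card : ℝ)
    have hd0 : 0 ≤ d := by positivity
    have h9 : d ≤ t ^ 2 / 100 := by
      by_contra hcon
      push Not at hcon
      have h11 : t * Real.log (k + 1) ≤ t ^ 2 * (2 / 10 ^ 6) := by
        have : Real.log (k + 1) ≤ t * (2 / 10 ^ 6) := by linarith
        calc _ ≤ t * (t * (2 / 10 ^ 6)) := by gcongr
          _ = _ := by ring
      have h10 : t ^ 2 / 100 * 0.693 ≤ d * Real.log 2 := by
        apply mul_le_mul hcon.le (by linarith) (by norm_num) hd0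
      have : (10 : ℝ) ^ 24 ≤ t ^ 2 := by nlinarith
      linarith
    linarith
  · intro S A col hS hA hd hc
    have h4 := h3 (mkg k S A col)
    have h5 := Real.log_lt_log (by positivity) h4
    rw [Real.log_mul (by positivity) (by positivity), Real.log_mul (by norm_num) (by positivity),
      Real.log_exp, Real.log_pow, Real.log_pow, Real.log_pow] at h5
    have h6 := unb_lower ω hS hA hd hc
    have h7 : ((accL (cfl k) (List.ofFn ω)).filter (fun x => x ∈ Xg k (mkg k S A col))).card ≤
        (F.edges.filter (fun e => ∃ s ∈ S, ∃ b ∈ A, ∃ c ∈ A, col b ≠ col c ∧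
          e = {s, b, c})).card := by
      apply Finset.card_le_card_of_injOn Subtype.val
      · intro x hx
        rw [Finset.mem_coe, Finset.mem_filter] at hx ⊢
        exact ⟨Finset.mem_image_of_mem _ hx.1, (mem_Xg hS hA hd hc x).mp hx.2⟩
      · exact Subtype.val_injective.injOn
    have h8 := supN_mkg k S A col
    have h6' : (S.card : ℝ) * (((A ×ˢ A).filter (fun p => col p.1 ≠ col p.2)).card : ℝ) ≤
      2 * ((unbL (cfl k) (Xg k (mkg k S A col)) (List.ofFn ω)).card : ℝ) +
      (((S ×ˢ (A ×ˢ A)).filter (fun p => p.2.1 ≠ p.2.2 ∧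
        (cov ω p.1 p.2.1 ∨ cov ω p.1 p.2.2 ∨ cov ω p.2.1 p.2.2))).card : ℝ) := by
      exact_mod_cast h6
    have h7' : (((accL (cfl k) (List.ofFn ω)).filter
        (fun x => x ∈ Xg k (mkg k S A col))).card : ℝ) ≤
        ((F.edges.filter (fun e => ∃ s ∈ S, ∃ b ∈ A, ∃ c ∈ A, col b ≠ col c ∧
          e = {s, b, c})).card : ℝ) := by exact_mod_cast h7
    have h8' : (supN k (mkg k S A col) : ℝ) ≤ S.card + A.card := by exact_mod_cast h8
    refine le_trans ?_ h7'
    set acc : ℝ := (((accL (cfl k) (List.ofFn ω)).filter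
        (fun x => x ∈ Xg k (mkg k S A col))).card : ℝ)
    set Un : ℝ := ((unbL (cfl k) (Xg k (mkg k S A col)) (List.ofFn ω)).card : ℝ)
    set n : ℝ := (supN k (mkg k S A col) : ℝ)
    have hacc : 0 ≤ acc := by positivity
    have hUn : 0 ≤ Un := by positivity
    have hn : 0 ≤ n := by positivity
    have hN : (Fintype.card (Tr k) : ℝ) ≤ (k : ℝ) ^ 3 / 6 := by
      rw [card_Tr_real k hk]; nlinarith
    have hN0 : (0 : ℝ) < Fintype.card (Tr k) := by
      have := nonempty_Tr k hk
      exact_mod_cast Fintype.card_pos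
    have h9 : 3 / (451 * k) * Un ≤ M * Un / (2 * Fintype.card (Tr k)) := by
      rw [div_mul_eq_mul_div, div_le_div_iff₀ (by positivity) (by positivity)]
      calc 3 * Un * (2 * (Fintype.card (Tr k) : ℝ)) ≤ 3 * Un * (2 * ((k : ℝ) ^ 3 / 6)) := by gcongr
        _ = (k : ℝ) ^ 2 / 451 * Un * (451 * k) := by ring
        _ ≤ M * Un * (451 * k) := by gcongr
    have h10 : 3 / (902 * k) * ((S.card : ℝ) *
        (((A ×ˢ A).filter (fun p => col p.1 ≠ col p.2)).card : ℝ) -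
          (((S ×ˢ (A ×ˢ A)).filter (fun p => p.2.1 ≠ p.2.2 ∧
            (cov ω p.1 p.2.1 ∨ cov ω p.1 p.2.2 ∨ cov ω p.2.1 p.2.2))).card : ℝ)) ≤
        3 / (451 * k) * Un := by
      calc _ ≤ 3 / (902 * (k : ℝ)) * (2 * Un) := by gcongr; linarith
        _ = _ := by field_simp; ring
    have hlp : 0 ≤ Real.log ((k : ℝ) + 2) := Real.log_nonneg (by linarith)
    have h11 : acc * Real.log 2 ≤ acc := by nlinarith
    have h12 : n * ((2 : ℕ) * Real.log (k + 2)) ≤ 4 * ((S.card : ℝ) + A.card) * L := by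
      calc n * ((2 : ℕ) * Real.log (k + 2)) ≤ ((S.card : ℝ) + A.card) * ((2 : ℕ) * (2 * L)) := by
            exact mul_le_mul h8' (by push_cast; linarith) (by push_cast; linarith) (by positivity)
        _ = _ := by push_cast; ring
    have h13 := h10.trans (h9.trans h5.le)
    refine le_trans (sub_le_sub_right (sub_le_sub_right h13 _) _) ?_
    linarith

open Classical in
/-- Bound on the blocked ordered triples. -/
theorem blocked_le (cv : ℕ → ℕ → Prop) (S A : Finset ℕ) (hd : Disjoint S A) (p q : ℝ)
    (h1 : (((S ×ˢ A).filter (fun x => x.1 ≠ x.2 ∧ cv x.1 x.2)).card : ℝ) ≤ p)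
    (h2 : (((A ×ˢ A).filter (fun x => x.1 ≠ x.2 ∧ cv x.1 x.2)).card : ℝ) ≤ q) :
    (((S ×ˢ (A ×ˢ A)).filter (fun p => p.2.1 ≠ p.2.2 ∧
            (cv p.1 p.2.1 ∨ cv p.1 p.2.2 ∨ cv p.2.1 p.2.2))).card : ℝ) ≤
      2 * A.card * p + S.card * q := by
  have hne : ∀ s ∈ S, ∀ b ∈ A, s ≠ b := fun s hs b hb h =>
    Finset.disjoint_left.mp hd hs (h ▸ hb)
  set C1 := (S ×ˢ A).filter (fun x => x.1 ≠ x.2 ∧ cv x.1 x.2)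
  set C2 := (A ×ˢ A).filter (fun x => x.1 ≠ x.2 ∧ cv x.1 x.2)
  have hsub : (S ×ˢ (A ×ˢ A)).filter (fun p => p.2.1 ≠ p.2.2 ∧
            (cv p.1 p.2.1 ∨ cv p.1 p.2.2 ∨ cv p.2.1 p.2.2)) ⊆
      ((C1 ×ˢ A).image (fun x => (x.1.1, x.1.2, x.2)) ∪
        (C1 ×ˢ A).image (fun x => (x.1.1, x.2, x.1.2))) ∪ (S ×ˢ C2) := by
    rintro ⟨s, b, c⟩ hp
    simp only [Finset.mem_filter, Finset.mem_product] at hp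
    obtain ⟨⟨hs, hb, hc⟩, hbc, h⟩ := hp
    simp only [Finset.mem_union, Finset.mem_image, Finset.mem_product, C1, C2, Finset.mem_filter]
    rcases h with h | h | h
    · exact Or.inl (Or.inl ⟨((s, b), c), ⟨⟨⟨hs, hb⟩, hne s hs b hb, h⟩, hc⟩, rfl⟩)
    · exact Or.inl (Or.inr ⟨((s, c), b), ⟨⟨⟨hs, hc⟩, hne s hs c hc, h⟩, hb⟩, rfl⟩)
    · exact Or.inr ⟨hs, ⟨hb, hc⟩, hbc, h⟩
  have h3 := Finset.card_le_card hsub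
  have h4 := Finset.card_union_le ((C1 ×ˢ A).image (fun x => (x.1.1, x.1.2, x.2)) ∪
        (C1 ×ˢ A).image (fun x => (x.1.1, x.2, x.1.2))) (S ×ˢ C2)
  have h5 := Finset.card_union_le ((C1 ×ˢ A).image (fun x => (x.1.1, x.1.2, x.2)))
        ((C1 ×ˢ A).image (fun x => (x.1.1, x.2, x.1.2)))
  have h6 := Finset.card_image_le (s := C1 ×ˢ A) (f := fun x => (x.1.1, x.1.2, x.2))
  have h7 := Finset.card_image_le (s := C1 ×ˢ A) (f := fun x => (x.1.1, x.2, x.1.2))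
  rw [Finset.card_product] at h4 h6 h7
  have h8 := h3.trans (h4.trans (Nat.add_le_add_right (h5.trans (Nat.add_le_add h6 h7)) _))
  have h9 : (((S ×ˢ (A ×ˢ A)).filter (fun p => p.2.1 ≠ p.2.2 ∧
            (cv p.1 p.2.1 ∨ cv p.1 p.2.2 ∨ cv p.2.1 p.2.2))).card : ℝ) ≤
      (C1.card * A.card + C1.card * A.card) + S.card * C2.card := by exact_mod_cast h8
  refine h9.trans ?_
  have : (C1.card : ℝ) * A.card ≤ p * A.card := by gcongr
  have : (S.card : ℝ) * C2.card ≤ S.card * q := by gcongr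
  linarith

open Classical in
theorem cross_le_left (cv : ℕ → ℕ → Prop) (S A : Finset ℕ) (D : ℝ)
    (h : ∀ v ∈ S, ((A.filter (fun w => w ≠ v ∧ cv v w)).card : ℝ) ≤ D) :
    (((S ×ˢ A).filter (fun x => x.1 ≠ x.2 ∧ cv x.1 x.2)).card : ℝ) ≤ S.card * D := by
  have h1 : ((S ×ˢ A).filter (fun x => x.1 ≠ x.2 ∧ cv x.1 x.2)).card =
      ∑ s ∈ S, (A.filter (fun w => w ≠ s ∧ cv s w)).card := by
    rw [Finset.card_filter, Finset.sum_product]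
    refine Finset.sum_congr rfl fun s _ => ?_
    rw [Finset.card_filter]
    refine Finset.sum_congr rfl fun w _ => ?_
    simp only [ne_comm]
  rw [h1]
  push_cast
  refine (Finset.sum_le_sum h).trans ?_
  rw [Finset.sum_const, nsmul_eq_mul]

open Classical in
theorem cross_le_right (cv : ℕ → ℕ → Prop) (hs : ∀ b c, cv b c → cv c b) (S A : Finset ℕ) (D : ℝ)
    (h : ∀ v ∈ A, ((S.filter (fun w => w ≠ v ∧ cv v w)).card : ℝ) ≤ D) :
    (((S ×ˢ A).filter (fun x => x.1 ≠ x.2 ∧ cv x.1 x.2)).card : ℝ) ≤ A.card * D := by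
  have h1 : ((S ×ˢ A).filter (fun x => x.1 ≠ x.2 ∧ cv x.1 x.2)).card =
      ∑ a ∈ A, (S.filter (fun w => w ≠ a ∧ cv a w)).card := by
    rw [Finset.card_filter, Finset.sum_product_right]
    refine Finset.sum_congr rfl fun s _ => ?_
    rw [Finset.card_filter]
    refine Finset.sum_congr rfl fun w _ => ?_
    have : cv w s ↔ cv s w := ⟨hs _ _, hs _ _⟩
    simp only [this]
  rw [h1]
  push_cast
  refine (Finset.sum_le_sum h).trans ?_
  rw [Finset.sum_const, nsmul_eq_mul]

open Classical in
theorem card_Q_id (A : Finset ℕ) :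
    (((A ×ˢ A).filter (fun p => id p.1 ≠ id p.2)).card : ℝ) = (A.card : ℝ) * (A.card - 1) := by
  have h : (A ×ˢ A).filter (fun p => id p.1 ≠ id p.2) = A.offDiag := by
    ext ⟨b, c⟩
    simp [Finset.mem_offDiag, and_assoc]
  rw [h, Finset.offDiag_card, Nat.cast_sub (Nat.le_mul_self _)]
  push_cast; ring

theorem num_one (k m s a L K : ℝ) (hk : 0 < k) (hL : 10 ^ 6 ≤ L) (hK : 10 ^ 6 * L ≤ K)
    (hm : 100 ≤ m) (hmk : k * K ≤ m ^ 2) (hsa : s + a = m) (hs : m - 1 ≤ 2 * s)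
    (hs' : 2 * s ≤ m) (U : ℝ)
    (hU : U ≤ 2 * a * (6 / 100 * m ^ 2) + s * (6 / 100 * m ^ 2)) :
    0 < 3 / (902 * k) * (s * (a * (a - 1)) - U) - 4 * (s + a) * L - 3 := by
  have ha : a = m - s := by linarith
  have ha1 : m / 2 ≤ a := by linarith
  have h1 : m * (m - 1) * (m - 2) / 8 ≤ s * (a * (a - 1)) := by
    have e1 : m / 2 * (m / 2 - 1) ≤ a * (a - 1) := by nlinarith
    have e2 : (m - 1) / 2 * (m / 2 * (m / 2 - 1)) ≤ s * (a * (a - 1)) := by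
      apply mul_le_mul (by linarith) e1 _ (by linarith)
      exact mul_nonneg (by linarith) (by linarith)
    nlinarith
  have h2 : U ≤ 9 / 100 * m ^ 3 + 6 / 100 * m ^ 2 := by
    have : 2 * a + s ≤ 3 / 2 * m + 1 := by linarith
    have := mul_le_mul_of_nonneg_right this (show 0 ≤ 6 / 100 * m ^ 2 by positivity)
    nlinarith
  have h3 : 3 / 100 * m ^ 3 ≤ s * (a * (a - 1)) - U := by
    have : 100 * m ^ 2 ≤ m ^ 3 := by nlinarith [sq_nonneg m]
    nlinarith
  have h4 : 3 / (902 * k) * (3 / 100 * m ^ 3) ≤ 3 / (902 * k) * (s * (a * (a - 1)) - U) := by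
    gcongr
  have h5 : 9 / 90200 * (K * m) ≤ 3 / (902 * k) * (3 / 100 * m ^ 3) := by
    rw [div_mul_eq_mul_div, div_mul_eq_mul_div, div_le_div_iff₀ (by norm_num) (by positivity)]
    have := mul_le_mul_of_nonneg_right hmk (show 0 ≤ m by linarith)
    nlinarith
  have h6 : 10 ^ 6 * L * m ≤ K * m := by gcongr
  have h7 : 1 ≤ L * m := by nlinarith
  rw [hsa]
  nlinarith

theorem num_two (k s t L R : ℝ) (hk : 0 < k) (hL : 10 ^ 6 ≤ L) (hR : 10 ^ 12 ≤ R)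
    (hRL : 10 ^ 6 * L ≤ R)
    (hRR : R * R = k) (hs : L ^ 2 < s) (ht : R * L < t) (hor : k / 8 ≤ s ∨ k / 8 ≤ t) (U : ℝ)
    (hU : U ≤ 2 * t * (16 / 100 * s * t) + s * (6 / 100 * t ^ 2)) :
    0 < 3 / (902 * k) * (s * (t * (t - 1)) - U) - 4 * (s + t) * L - 3 := by
  have hs0 : 0 < s := lt_trans (by positivity) hs
  have hL0 : 0 < L := lt_of_lt_of_le (by norm_num) hL
  have hR0 : 0 < R := lt_of_lt_of_le (by norm_num) hR
  have ht0 : 0 < t := lt_trans (by positivity) ht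
  have ht1 : 100 ≤ t := by nlinarith
  have h1 : 6 / 10 * (s * t ^ 2) ≤ s * (t * (t - 1)) - U := by
    have : s * t * 100 ≤ s * t * t := by gcongr
    nlinarith
  have h2 : 3 / (902 * k) * (6 / 10 * (s * t ^ 2)) ≤ 3 / (902 * k) * (s * (t * (t - 1)) - U) := by
    gcongr
  have h3 : 10 ^ 6 * (s * L) ≤ s * t ^ 2 / k := by
    rw [le_div_iff₀ hk]
    have e1 : R * L * (R * L) ≤ t * t := by gcongr
    have e2 : s * (k * (L * L)) ≤ s * t ^ 2 := by
      have : k * (L * L) ≤ t ^ 2 := by rw [← hRR]; nlinarith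
      gcongr
    have e3 : s * k * L * 10 ^ 6 ≤ s * k * L * L := by gcongr
    nlinarith
  have h4 : 10 ^ 5 * (t * L) ≤ s * t ^ 2 / k := by
    rw [le_div_iff₀ hk]
    rcases hor with h | h
    · have e1 : k / 8 * t ^ 2 ≤ s * t ^ 2 := by gcongr
      have e2 : k * t * (10 ^ 6 * L) ≤ k * t * t := by
        have : R * 1 ≤ R * L := by gcongr; linarith
        gcongr; linarith
      nlinarith
    · have e1 : s * t * (k / 8) ≤ s * t * t := by gcongr
      have e2 : L * 10 ^ 6 ≤ s := by nlinarith
      have e3 : (L * 10 ^ 6) * (t * k) ≤ s * (t * k) := by gcongr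
      nlinarith
  have h5 : 3 / (902 * k) * (6 / 10 * (s * t ^ 2)) = 18 / 9020 * (s * t ^ 2 / k) := by
    field_simp; norm_num
  have h6 : 1 ≤ t * L := by nlinarith
  have h7 : 0 < s * L := by positivity
  nlinarith

theorem num_three (k s a σ L R : ℝ) (hk : 0 < k) (hL : 10 ^ 6 ≤ L) (hR : 10 ^ 12 ≤ R)
    (hRL : 10 ^ 6 * L ^ 3 ≤ R) (hRR : R * R = k) (hs : k / 4 < s) (ha : k / (16 * L) ≤ a)
    (hsa : s + a ≤ k) (hσ : a ^ 2 - R * L * a ≤ σ) (U Q : ℝ) (hQ : σ ≤ Q)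
    (hU : U ≤ 2 * a * (8 / 100 * a * s) + s * (6 / 100 * a ^ 2)) :
    s / (500 * k) * σ ≤ 3 / (902 * k) * (s * Q - U) - 4 * (s + a) * L - 3 := by
  have hs0 : 0 < s := by linarith
  have hL0 : 0 < L := lt_of_lt_of_le (by norm_num) hL
  have hR0 : 0 < R := lt_of_lt_of_le (by norm_num) hR
  have ha0 : 0 < a := lt_of_lt_of_le (by positivity) ha
  have ha' : k ≤ a * (16 * L) := by rwa [div_le_iff₀ (by positivity)] at ha
  have hL3 : L ^ 2 ≤ L ^ 3 := by nlinarith [sq_nonneg L]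
  have h1 : 100 * (R * L) ≤ a := by
    have : 100 * (R * L) * (16 * L) ≤ a * (16 * L) := by
      refine le_trans ?_ ha'
      have : 1600 * L ^ 2 ≤ R := by nlinarith
      have : R * (1600 * L ^ 2) ≤ R * R := by gcongr
      nlinarith
    exact le_of_mul_le_mul_right this (by positivity)
  have h2 : 99 / 100 * a ^ 2 ≤ σ := by nlinarith
  have h3 : s * σ ≤ s * Q := by gcongr
  have h4 : U ≤ s * (22 / 100 * a ^ 2) := by nlinarith
  have h5 : s * (22 / 100 * a ^ 2) ≤ s * (22 / 99 * σ) := by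
    have : 22 / 100 * a ^ 2 ≤ 22 / 99 * σ := by linarith
    exact mul_le_mul_of_nonneg_left this hs0.le
  have h6 : 77 / 99 * (s * σ) ≤ s * Q - U := by nlinarith
  have h7 : 3 / (902 * k) * (77 / 99 * (s * σ)) ≤ 3 / (902 * k) * (s * Q - U) := by gcongr
  have h8 : s / (500 * k) * σ + 5 / 10000 * (s * σ / k) ≤ 3 / (902 * k) * (77 / 99 * (s * σ)) := by
    have e1 : s / (500 * k) * σ = 1 / 500 * (s * σ / k) := by field_simp
    have e2 : 3 / (902 * k) * (77 / 99 * (s * σ)) = (3 * 77) / (902 * 99) * (s * σ / k) := by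
      field_simp
    rw [e1, e2]
    have : 0 ≤ s * σ / k := by
      have : 0 ≤ σ := le_trans (by positivity) h2
      positivity
    nlinarith
  have h9 : 10 * (k * L) ≤ 5 / 10000 * (s * σ / k) := by
    have e1 : k / 4 * (99 / 100 * a ^ 2) ≤ s * σ := by gcongr
    have e2 : 99 / 400 * a ^ 2 ≤ s * σ / k := by
      rw [le_div_iff₀ hk]; nlinarith
    have e3 : 10 ^ 6 * (k * L) ≤ a ^ 2 := by
      have f1 : k * k ≤ (a * (16 * L)) * (a * (16 * L)) := by gcongr
      have f2 : 10 ^ 6 * (k * L) * (256 * L ^ 2) ≤ k * k := by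
        have : 256 * 10 ^ 6 * L ^ 3 ≤ k := by
          rw [← hRR]
          have : 10 ^ 12 * (10 ^ 6 * L ^ 3) ≤ R * R := by gcongr
          have : 0 < L ^ 3 := by positivity
          nlinarith
        have : k * (256 * 10 ^ 6 * L ^ 3) ≤ k * k := by gcongr
        nlinarith
      have f3 : 10 ^ 6 * (k * L) * (256 * L ^ 2) ≤ a ^ 2 * (256 * L ^ 2) := by nlinarith
      exact le_of_mul_le_mul_right f3 (by positivity)
    have : 0 ≤ k * L := by positivity
    linarith
  have h10 : 4 * (s + a) * L ≤ 4 * k * L := by gcongr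
  have h11 : 1 ≤ k * L := by
    have hk1 : 1 ≤ k := by rw [← hRR]; nlinarith
    exact one_le_mul_of_one_le_of_one_le hk1 (by linarith)
  linarith

theorem sum_offdiag (t : ℕ) (x : Fin t → ℝ) (B : ℝ) (h0 : ∀ i, 0 ≤ x i) (hB : ∀ i, x i ≤ B) :
    (∑ i, x i) ^ 2 - B * ∑ i, x i ≤
      ∑ i : Fin t, ∑ j : Fin t, if i = j then 0 else x i * x j := by
  have h1 : ∀ i, ∑ j : Fin t, (if i = j then 0 else x i * x j) = x i * ∑ j, x j - x i * x i := by
    intro i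
    have : ∀ j, (if i = j then 0 else x i * x j) = x i * x j - (if i = j then x i * x j else 0) := by
      intro j; split_ifs <;> ring
    simp only [this, Finset.sum_sub_distrib, Finset.sum_ite_eq, Finset.mem_univ, if_true,
      Finset.mul_sum]
  simp only [h1, Finset.sum_sub_distrib, ← Finset.sum_mul]
  have h2 : ∑ i, x i * x i ≤ B * ∑ i, x i := by
    rw [Finset.mul_sum]
    exact Finset.sum_le_sum fun i _ => mul_le_mul_of_nonneg_right (hB i) (h0 i)
  nlinarith

open Classical in
theorem card_Q_parts (t : ℕ) (A : Fin t → Finset ℕ) (hd : ∀ i j, i ≠ j → Disjoint (A i) (A j))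
    (col : ℕ → ℕ) (hcol : ∀ i, ∀ v ∈ A i, col v ∈ A i) :
    (∑ i : Fin t, ∑ j : Fin t, if i = j then 0 else ((A i).card : ℝ) * ((A j).card : ℝ)) ≤
      ((((Finset.univ.biUnion A) ×ˢ (Finset.univ.biUnion A)).filter
        (fun p => col p.1 ≠ col p.2)).card : ℝ) := by
  have hpd : Set.PairwiseDisjoint (↑(Finset.univ : Finset (Fin t))) A :=
    fun i _ j _ hij => hd i j hij
  rw [Finset.card_filter, Finset.sum_product, Finset.sum_biUnion hpd]
  push_cast
  refine Finset.sum_le_sum fun i _ => ?_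
  have h1 : (∑ j : Fin t, if i = j then 0 else ((A i).card : ℝ) * ((A j).card : ℝ)) =
      ∑ _b ∈ A i, ∑ j : Fin t, if i = j then 0 else ((A j).card : ℝ) := by
    rw [Finset.sum_const, nsmul_eq_mul, Finset.mul_sum]
    refine Finset.sum_congr rfl fun j _ => ?_
    split_ifs <;> simp
  rw [h1]
  refine Finset.sum_le_sum fun b hb => ?_
  rw [Finset.sum_biUnion hpd]
  refine Finset.sum_le_sum fun j _ => ?_
  split_ifs with hij
  · exact Finset.sum_nonneg fun c _ => by split_ifs <;> norm_num
  · have : ∀ c ∈ A j, (if col b ≠ col c then (1 : ℝ) else 0) = 1 := by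
      intro c hc
      rw [if_pos]
      intro heq
      have e1 := hcol i b hb
      have e2 := hcol j c hc
      rw [heq] at e1
      exact Finset.disjoint_left.mp (hd i j hij) e1 e2
    simp only [Finset.sum_congr rfl this]
    simp

/-- For all sufficiently large `k` there is a linear 3-graph `F` on the
vertex set `{1,…,k}` such that: (1) every vertex subset of size `⌈k^{3/5}⌉` contains an edge;
(2) for disjoint `S, T` with `|S ∪ T| > k/4`, `|S| > (log k)²`, `|T| > √k · log k` there is an
edge with one vertex in `S` and two in `T`; (3) for pairwise disjoint `A_1, …, A_t, S` with
`|S| > k/4`, `|A_i| ≤ √k · log k` and `|A_1 ∪ ⋯ ∪ A_t| ≥ k/(16 log k)`, the number of edges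
with one vertex in `S` and the other two in distinct parts `A_i, A_j` is at least
`(|S|/(500k)) · Σ_{i ≠ j} |A_i||A_j|`. -/
theorem exists_good_linear_system :
    ∃ k₀ : ℕ, ∀ k : ℕ, k₀ ≤ k →
      ∃ F : ThreeGraph, F.verts = Finset.Icc 1 k ∧ LinearTG F ∧
        (∀ W : Finset ℕ, W ⊆ Finset.Icc 1 k → W.card = ⌈(k : ℝ) ^ ((3 : ℝ) / 5)⌉₊ →
          ∃ e ∈ F.edges, e ⊆ W) ∧
        (∀ S T : Finset ℕ, S ⊆ Finset.Icc 1 k → T ⊆ Finset.Icc 1 k → Disjoint S T →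
          (k : ℝ) / 4 < ((S ∪ T).card : ℝ) → Real.log k ^ 2 < (S.card : ℝ) →
          Real.sqrt k * Real.log k < (T.card : ℝ) →
          ∃ e ∈ F.edges, ∃ a ∈ S, ∃ b ∈ T, ∃ c ∈ T, b ≠ c ∧ e = {a, b, c}) ∧
        (∀ (t : ℕ) (A : Fin t → Finset ℕ) (S : Finset ℕ),
          (∀ i, A i ⊆ Finset.Icc 1 k) → S ⊆ Finset.Icc 1 k →
          (∀ i j, i ≠ j → Disjoint (A i) (A j)) → (∀ i, Disjoint (A i) S) →
          (k : ℝ) / 4 < (S.card : ℝ) →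
          (∀ i, ((A i).card : ℝ) ≤ Real.sqrt k * Real.log k) →
          (k : ℝ) / (16 * Real.log k) ≤ ((Finset.univ.biUnion A).card : ℝ) →
          (S.card : ℝ) / (500 * k) *
              (∑ i : Fin t, ∑ j : Fin t,
                if i = j then 0 else ((A i).card : ℝ) * ((A j).card : ℝ)) ≤
            (Set.ncard {e : Finset ℕ | e ∈ F.edges ∧ ∃ a ∈ S, ∃ i j : Fin t, i ≠ j ∧
              ∃ b ∈ A i, ∃ c ∈ A j, e = {a, b, c}} : ℝ)) := by
  classical
  obtain ⟨k₀, hk₀⟩ := eventually_big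
  refine ⟨k₀, fun k hkk => ?_⟩
  have hB := hk₀ k hkk
  obtain ⟨F, hV, hlin, cv, hsym, hdeg, hpair, hcore⟩ := core k hB
  obtain ⟨hk, hL, hR, hK⟩ := hB
  have hk3 : (3 : ℝ) ≤ k := by exact_mod_cast hk
  have hk0 : (0 : ℝ) < k := by linarith
  have hRR : Real.sqrt k * Real.sqrt k = k := Real.mul_self_sqrt (by positivity)
  have hL1 : (1 : ℝ) ≤ Real.log k := le_trans (by norm_num) hL
  have hL3 : Real.log k ≤ Real.log k ^ 3 := by
    nlinarith [sq_nonneg (Real.log k), mul_nonneg (sub_nonneg.2 hL1) (sub_nonneg.2 hL1)]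
  have hRL : 10 ^ 6 * Real.log k ≤ Real.sqrt k := le_trans (by linarith) hR
  have hR12 : 10 ^ 12 ≤ Real.sqrt k := by linarith
  refine ⟨F, hV, hlin, ?_, ?_, ?_⟩
  · intro W hW hWc
    set m := W.card with hm
    have hm1 : (k : ℝ) ^ ((3 : ℝ) / 5) ≤ m := by rw [hWc]; exact Nat.le_ceil _
    have hmR : Real.sqrt k ≤ m := by
      refine le_trans ?_ hm1
      rw [Real.sqrt_eq_rpow]
      exact Real.rpow_le_rpow_of_exponent_le (by linarith) (by norm_num)
    have hmk : (k : ℝ) * (k : ℝ) ^ ((1 : ℝ) / 5) ≤ (m : ℝ) ^ 2 := by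
      have e1 : (k : ℝ) * (k : ℝ) ^ ((1 : ℝ) / 5) = ((k : ℝ) ^ ((3 : ℝ) / 5)) ^ 2 := by
        rw [← Real.rpow_natCast, ← Real.rpow_mul hk0.le]
        nth_rewrite 1 [← Real.rpow_one (k : ℝ)]
        rw [← Real.rpow_add hk0]; norm_num
      rw [e1]; gcongr
    obtain ⟨S, hSW, hSc⟩ := Finset.exists_subset_card_eq (show m / 2 ≤ W.card by omega)
    have hAc : (W \ S).card = m - m / 2 := by rw [Finset.card_sdiff_of_subset hSW, hSc]
    have hAW : W \ S ⊆ W := Finset.sdiff_subset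
    have hd : Disjoint S (W \ S) := Finset.disjoint_sdiff
    have hc := hcore S (W \ S) id (hSW.trans hW) (hAW.trans hW) hd (fun v hv => hW (hAW hv))
    rw [card_Q_id] at hc
    have hp := hpair W hW hmR
    have e1 : ((((S) ×ˢ (W \ S)).filter (fun x => x.1 ≠ x.2 ∧ cv x.1 x.2)).card : ℝ) ≤
        (((W ×ˢ W).filter (fun x => x.1 ≠ x.2 ∧ cv x.1 x.2)).card : ℝ) := by
      have := Finset.card_le_card (Finset.filter_subset_filter (fun x => x.1 ≠ x.2 ∧ cv x.1 x.2)
        (Finset.product_subset_product hSW hAW))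
      exact_mod_cast this
    have e2 : ((((W \ S) ×ˢ (W \ S)).filter (fun x => x.1 ≠ x.2 ∧ cv x.1 x.2)).card : ℝ) ≤
        (((W ×ˢ W).filter (fun x => x.1 ≠ x.2 ∧ cv x.1 x.2)).card : ℝ) := by
      have := Finset.card_le_card (Finset.filter_subset_filter (fun x => x.1 ≠ x.2 ∧ cv x.1 x.2)
        (Finset.product_subset_product hAW hAW))
      exact_mod_cast this
    have hb := blocked_le cv S (W \ S) hd _ _ (e1.trans hp) (e2.trans hp)
    have hsum : (S.card : ℝ) + (W \ S).card = m := by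
      have : S.card + (W \ S).card = m := by omega
      exact_mod_cast this
    have hs1 : (m : ℝ) - 1 ≤ 2 * S.card := by
      have : m ≤ 2 * S.card + 1 := by omega
      have : (m : ℝ) ≤ 2 * S.card + 1 := by exact_mod_cast this
      linarith
    have hs2 : 2 * (S.card : ℝ) ≤ m := by
      have : 2 * S.card ≤ m := by omega
      exact_mod_cast this
    have hpos := num_one k m S.card (W \ S).card (Real.log k) _ hk0 hL hK (by linarith) hmk hsum
      hs1 hs2 _ hb
    have hlt := lt_of_lt_of_le hpos hc
    have hlt' := Nat.cast_pos.mp hlt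
    obtain ⟨e, he⟩ := Finset.card_pos.mp hlt'
    obtain ⟨heF, s, hs, b, hb', c, hc', -, rfl⟩ := Finset.mem_filter.mp he
    refine ⟨_, heF, ?_⟩
    intro x hx
    simp only [Finset.mem_insert, Finset.mem_singleton] at hx
    rcases hx with rfl | rfl | rfl
    exacts [hSW hs, hAW hb', hAW hc']
  · intro S T hS hT hd hST hSl hTl
    have hc := hcore S T id hS hT hd (fun v hv => hT hv)
    rw [card_Q_id] at hc
    have hTR : Real.sqrt k ≤ T.card := by nlinarith
    have hp := hpair T hT hTR
    have hST' : (k : ℝ) / 4 < S.card + T.card := by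
      rw [Finset.card_union_of_disjoint hd] at hST
      exact_mod_cast hST
    have hor : (k : ℝ) / 8 ≤ S.card ∨ (k : ℝ) / 8 ≤ T.card := by
      by_contra hcon
      push Not at hcon
      linarith
    have hcross : (((S ×ˢ T).filter (fun x => x.1 ≠ x.2 ∧ cv x.1 x.2)).card : ℝ) ≤
        16 / 100 * S.card * T.card := by
      rcases hor with h | h
      · refine (cross_le_right cv hsym S T (k / 50) (fun v hv => hdeg v (hT hv) S)).trans ?_
        have : (T.card : ℝ) * (k / 8) ≤ T.card * S.card := by gcongr
        linarith
      · refine (cross_le_left cv S T (k / 50) (fun v hv => hdeg v (hS hv) T)).trans ?_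
        have : (S.card : ℝ) * (k / 8) ≤ S.card * T.card := by gcongr
        linarith
    have hb := blocked_le cv S T hd _ _ hcross hp
    have hpos := num_two k S.card T.card (Real.log k) (Real.sqrt k) hk0 hL hR12 hRL hRR hSl hTl
      hor _ hb
    have hlt := lt_of_lt_of_le hpos hc
    have hlt' := Nat.cast_pos.mp hlt
    obtain ⟨e, he⟩ := Finset.card_pos.mp hlt'
    obtain ⟨heF, s, hs, b, hb', c, hc', hbc, rfl⟩ := Finset.mem_filter.mp he
    exact ⟨_, heF, s, hs, b, hb', c, hc', hbc, rfl⟩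
  · intro t A S hA hS hAd hAS hSl hAl hUl
    set AA := Finset.univ.biUnion A with hAA
    have hAAsub : AA ⊆ Finset.Icc 1 k := Finset.biUnion_subset.mpr fun i _ => hA i
    have hd : Disjoint S AA := by
      rw [hAA, Finset.disjoint_biUnion_right]
      exact fun i _ => (hAS i).symm
    let col : ℕ → ℕ := fun v => sInf {w | ∃ i, v ∈ A i ∧ w ∈ A i}
    have hcol : ∀ i, ∀ v ∈ A i, col v ∈ A i := by
      intro i v hv
      have hne : {w | ∃ i, v ∈ A i ∧ w ∈ A i}.Nonempty := ⟨v, i, hv, hv⟩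
      obtain ⟨j, hj1, hj2⟩ := Nat.sInf_mem hne
      have hij : i = j := by
        by_contra hij
        exact Finset.disjoint_left.mp (hAd i j hij) hv hj1
      rw [hij]; exact hj2
    have hcolA : ∀ v ∈ AA, col v ∈ Finset.Icc 1 k := by
      intro v hv
      obtain ⟨i, -, hi⟩ := Finset.mem_biUnion.mp hv
      exact hA i (hcol i v hi)
    have hc := hcore S AA col hS hAAsub hd hcolA
    have hQ := card_Q_parts t A hAd col hcol
    have hcardA : (AA.card : ℝ) = ∑ i, ((A i).card : ℝ) := by
      rw [hAA, Finset.card_biUnion (fun i _ j _ hij => hAd i j hij)]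
      push_cast; rfl
    have hσ := sum_offdiag t (fun i => ((A i).card : ℝ)) _ (fun i => by positivity) hAl
    rw [← hcardA] at hσ
    have hAR : Real.sqrt k ≤ AA.card := by
      refine le_trans ?_ hUl
      rw [le_div_iff₀ (by positivity)]
      have : Real.sqrt k * (16 * Real.log k) ≤ Real.sqrt k * Real.sqrt k := by
        gcongr; linarith
      linarith
    have hp := hpair AA hAAsub hAR
    have hcross : (((S ×ˢ AA).filter (fun x => x.1 ≠ x.2 ∧ cv x.1 x.2)).card : ℝ) ≤
        8 / 100 * AA.card * S.card := by
      refine (cross_le_right cv hsym S AA (k / 50) (fun v hv => hdeg v (hAAsub hv) S)).trans ?_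
      have : (AA.card : ℝ) * (k / 4) ≤ AA.card * S.card := by gcongr
      linarith
    have hb := blocked_le cv S AA hd _ _ hcross hp
    have hsum : (S.card : ℝ) + AA.card ≤ k := by
      have h1 := Finset.card_le_card (Finset.union_subset hS hAAsub)
      rw [Finset.card_union_of_disjoint hd, Nat.card_Icc, Nat.add_sub_cancel] at h1
      exact_mod_cast h1
    have hfin := num_three k S.card AA.card _ (Real.log k) (Real.sqrt k) hk0 hL hR12 hR hRR hSl hUl
      hsum hσ _ _ hQ hb
    refine (hfin.trans hc).trans ?_
    rw [← Set.ncard_coe_finset]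
    have hfinset : {e : Finset ℕ | e ∈ F.edges ∧ ∃ a ∈ S, ∃ i j : Fin t, i ≠ j ∧
              ∃ b ∈ A i, ∃ c ∈ A j, e = {a, b, c}}.Finite :=
      F.edges.finite_toSet.subset fun e he => he.1
    have hle := Set.ncard_le_ncard (s := ↑(F.edges.filter (fun e => ∃ s ∈ S, ∃ b ∈ AA, ∃ c ∈ AA,
      col b ≠ col c ∧ e = {s, b, c}))) (t := {e : Finset ℕ | e ∈ F.edges ∧ ∃ a ∈ S,
        ∃ i j : Fin t, i ≠ j ∧ ∃ b ∈ A i, ∃ c ∈ A j, e = {a, b, c}}) (by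
        intro e he
        rw [Finset.mem_coe, Finset.mem_filter] at he
        obtain ⟨heF, s, hs, b, hb', c, hc', hbc, rfl⟩ := he
        obtain ⟨i, -, hi⟩ := Finset.mem_biUnion.mp hb'
        obtain ⟨j, -, hj⟩ := Finset.mem_biUnion.mp hc'
        refine ⟨heF, s, hs, i, j, ?_, b, hi, c, hj, rfl⟩
        rintro rfl
        apply hbc
        have hset : ∀ v ∈ A i, {w | ∃ l, v ∈ A l ∧ w ∈ A l} = {w | w ∈ A i} := by
          intro v hv
          ext w
          constructor
          · rintro ⟨l, h1, h2⟩
            have hil : i = l := by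
              by_contra hij
              exact Finset.disjoint_left.mp (hAd i l hij) hv h1
            rw [hil]; exact h2
          · exact fun h => ⟨i, hv, h⟩
        simp only [col, hset b hi, hset c hj]) hfinset
    exact_mod_cast hle
end

section
/- There exists a nonempty 3-graph H with 1/3 < m_pair(H) < 1/2. -/
namespace MPairAux

/-- The example: eight edges on seven vertices. -/
def exEdges : Finset (Finset ℕ) :=
  {{0, 1, 6}, {0, 3, 5}, {0, 5, 6}, {1, 3, 4}, {2, 3, 4}, {2, 3, 6}, {2, 5, 6}, {4, 5, 6}}

def exH : ThreeGraph where
  verts := Finset.range 7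
  edges := exEdges
  card_eq := by decide
  subset_verts := by decide

/-- `w` and `w'` have the same position relative to the pair `u, v`. -/
def Same (u v w w' : ℕ) : Prop :=
  ((u < w ∧ v < w) ↔ (u < w' ∧ v < w')) ∧ ((w < u ∧ w < v) ↔ (w' < u ∧ w' < v))

theorem same_iff {u v w w' : ℕ} (h : Same u v w w') (huv : u ≠ v) (h1 : u ≠ w) (h2 : v ≠ w)
    (h3 : u ≠ w') (h4 : v ≠ w') : (u < w ↔ u < w') ∧ (v < w ↔ v < w') := by
  unfold Same at h
  omega

theorem no_order (x0 x1 x2 x3 x4 x5 x6 : ℕ)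
    (h01 : x0 ≠ x1) (h03 : x0 ≠ x3) (h05 : x0 ≠ x5) (h06 : x0 ≠ x6) (h16 : x1 ≠ x6)
    (h35 : x3 ≠ x5) (h56 : x5 ≠ x6) (h13 : x1 ≠ x3) (h14 : x1 ≠ x4) (h34 : x3 ≠ x4)
    (h23 : x2 ≠ x3) (h24 : x2 ≠ x4) (h26 : x2 ≠ x6) (h36 : x3 ≠ x6) (h25 : x2 ≠ x5)
    (h45 : x4 ≠ x5) (h46 : x4 ≠ x6)
    (a1 : Same x0 x6 x1 x5) (a2 : Same x0 x5 x6 x3) (a3 : Same x5 x6 x0 x2)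
    (a4 : Same x5 x6 x0 x4) (a5 : Same x2 x6 x5 x3) (a6 : Same x2 x3 x6 x4)
    (a7 : Same x3 x4 x2 x1) : False := by
  obtain ⟨b1, c1⟩ := same_iff a1 h06 h01 h16.symm h05 h56.symm
  obtain ⟨b2, c2⟩ := same_iff a2 h05 h06 h56 h03 h35.symm
  obtain ⟨b3, c3⟩ := same_iff a3 h56 h05.symm h06.symm h25.symm h26.symm
  obtain ⟨b4, c4⟩ := same_iff a4 h56 h05.symm h06.symm h45.symm h46.symm
  obtain ⟨b5, c5⟩ := same_iff a5 h26 h25 h56.symm h23 h36.symm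
  obtain ⟨b6, c6⟩ := same_iff a6 h23 h26 h36 h24 h34
  obtain ⟨b7, c7⟩ := same_iff a7 h34 h23.symm h24.symm h13.symm h14.symm
  clear a1 a2 a3 a4 a5 a6 a7
  rcases lt_or_gt_of_ne h56 with h | h <;> rcases lt_or_gt_of_ne h06 with h' | h' <;>
  rcases lt_or_gt_of_ne h05 with h'' | h'' <;> grind

theorem sorted_unique (ord : ℕ → ℕ) {a b c u v w : ℕ}
    (h : ({a, b, c} : Finset ℕ) = {u, v, w}) (h1 : ord a < ord b) (h2 : ord b < ord c)
    (h3 : ord u < ord v) (h4 : ord v < ord w) : u = a ∧ v = b ∧ w = c := by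
  have hu : u ∈ ({a, b, c} : Finset ℕ) := by rw [h]; simp
  have hv : v ∈ ({a, b, c} : Finset ℕ) := by rw [h]; simp
  have hw : w ∈ ({a, b, c} : Finset ℕ) := by rw [h]; simp
  simp only [Finset.mem_insert, Finset.mem_singleton] at hu hv hw
  rcases hu with rfl | rfl | rfl <;> rcases hv with rfl | rfl | rfl <;>
    rcases hw with rfl | rfl | rfl <;> first | omega | simp

theorem imageEdges_pair (ord : ℕ → ℕ) (f : Finset ℕ → ℕ) {a b c u v w : ℕ}
    (h1 : ord a < ord b) (h2 : ord b < ord c) (h3 : ord u < ord v) (h4 : ord v < ord w)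
    (hne : (f {a, b}, f {b, c}, f {a, c}) ≠ (f {u, v}, f {v, w}, f {u, w})) :
    imageEdges ord f {{a, b, c}, {u, v, w}} = 2 := by
  unfold imageEdges
  rw [← Set.ncard_pair hne]
  congr 1
  ext p
  simp only [Set.mem_setOf_eq, Finset.mem_insert, Finset.mem_singleton, Set.mem_insert_iff,
    Set.mem_singleton_iff]
  constructor
  · rintro ⟨e, he, x, y, z, hxyz, hx, hy, rfl⟩
    rcases he with rfl | rfl
    · obtain ⟨rfl, rfl, rfl⟩ := sorted_unique ord hxyz h1 h2 hx hy
      left; rfl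
    · obtain ⟨rfl, rfl, rfl⟩ := sorted_unique ord hxyz h3 h4 hx hy
      right; rfl
  · rintro (rfl | rfl)
    · exact ⟨_, Or.inl rfl, a, b, c, rfl, h1, h2, rfl⟩
    · exact ⟨_, Or.inr rfl, u, v, w, rfl, h3, h4, rfl⟩

theorem pairs_of_triple {a b c : ℕ} {s : Finset ℕ}
    (hs : s ∈ ({a, b, c} : Finset ℕ).powersetCard 2) :
    s = {a, b} ∨ s = {b, c} ∨ s = {a, c} := by
  obtain ⟨hsub, hcard⟩ := Finset.mem_powersetCard.mp hs
  obtain ⟨x, y, hxy, rfl⟩ := Finset.card_eq_two.mp hcard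
  have hx := hsub (Finset.mem_insert_self x {y})
  have hy := hsub (Finset.mem_insert_of_mem (Finset.mem_singleton_self y))
  simp only [Finset.mem_insert, Finset.mem_singleton] at hx hy
  rcases hx with rfl | rfl | rfl <;> rcases hy with rfl | rfl | rfl <;>
    simp_all [Finset.pair_comm]

theorem imageVerts_pair (f : Finset ℕ → ℕ) (a b c u v w : ℕ) :
    ((shadowOf {{a, b, c}, {u, v, w}}).image f) ⊆
      {f {a, b}, f {b, c}, f {a, c}, f {u, v}, f {v, w}, f {u, w}} := by
  intro x hx
  obtain ⟨s, hs, rfl⟩ := Finset.mem_image.mp hx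
  simp only [shadowOf, Finset.mem_biUnion, Finset.mem_insert, Finset.mem_singleton] at hs
  obtain ⟨e, rfl | rfl, hs⟩ := hs
  · rcases pairs_of_triple hs with rfl | rfl | rfl <;> simp
  · rcases pairs_of_triple hs with rfl | rfl | rfl <;> simp

theorem card_five {x1 x2 x3 y1 y2 y3 : ℕ} {S : Finset ℕ} (hS : S ⊆ {x1, x2, x3, y1, y2, y3})
    (h : x1 = y1 ∨ x1 = y2 ∨ x1 = y3 ∨ x2 = y1 ∨ x2 = y2 ∨ x2 = y3 ∨
      x3 = y1 ∨ x3 = y2 ∨ x3 = y3) : S.card ≤ 5 := by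
  have key : ∃ a b c d e : ℕ, S ⊆ {a, b, c, d, e} := by
    have h' : y1 ∈ ({x1, x2, x3} : Finset ℕ) ∨ y2 ∈ ({x1, x2, x3} : Finset ℕ) ∨
      y3 ∈ ({x1, x2, x3} : Finset ℕ) := by
      simp only [Finset.mem_insert, Finset.mem_singleton]
      omega
    rcases h' with h' | h' | h'
    · refine ⟨x1, x2, x3, y2, y3, hS.trans ?_⟩
      intro t; simp only [Finset.mem_insert, Finset.mem_singleton] at h' ⊢; omega
    · refine ⟨x1, x2, x3, y1, y3, hS.trans ?_⟩
      intro t; simp only [Finset.mem_insert, Finset.mem_singleton] at h' ⊢; omega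
    · refine ⟨x1, x2, x3, y1, y2, hS.trans ?_⟩
      intro t; simp only [Finset.mem_insert, Finset.mem_singleton] at h' ⊢; omega
  obtain ⟨a, b, c, d, e, h⟩ := key
  exact (Finset.card_le_card h).trans Finset.card_le_five

/-- The set of densities. -/
def dens (H : ThreeGraph) (ord : ℕ → ℕ) (f : Finset ℕ → ℕ) : Set ℝ :=
  {r : ℝ | ∃ E' : Finset (Finset ℕ), E' ⊆ H.edges ∧ E'.Nonempty ∧
      r = (imageEdges ord f E' : ℝ) / (imageVerts f E' : ℝ)}

theorem dens_bdd (H : ThreeGraph) (ord : ℕ → ℕ) (f : Finset ℕ → ℕ) :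
    BddAbove (dens H ord f) := by
  apply Set.Finite.bddAbove
  apply ((H.edges.powerset.finite_toSet).image
    (fun E' => (imageEdges ord f E' : ℝ) / (imageVerts f E' : ℝ))).subset
  rintro r ⟨E', h, -, rfl⟩
  exact ⟨E', by simpa using h, rfl⟩

theorem triple_eq {H : ThreeGraph} {ord : ℕ → ℕ} {f : Finset ℕ → ℕ}
    (hq : sSup (dens H ord f) < 2 / 5) {a b c u v w : ℕ}
    (he : ({a, b, c} : Finset ℕ) ∈ H.edges) (he' : ({u, v, w} : Finset ℕ) ∈ H.edges)
    (h1 : ord a < ord b) (h2 : ord b < ord c) (h3 : ord u < ord v) (h4 : ord v < ord w)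
    (h : f {a, b} = f {u, v} ∨ f {a, b} = f {v, w} ∨ f {a, b} = f {u, w} ∨
      f {b, c} = f {u, v} ∨ f {b, c} = f {v, w} ∨ f {b, c} = f {u, w} ∨
      f {a, c} = f {u, v} ∨ f {a, c} = f {v, w} ∨ f {a, c} = f {u, w}) :
    f {a, b} = f {u, v} ∧ f {b, c} = f {v, w} ∧ f {a, c} = f {u, w} := by
  by_contra hne
  have hne' : (f {a, b}, f {b, c}, f {a, c}) ≠ (f {u, v}, f {v, w}, f {u, w}) := by
    simpa [Prod.ext_iff] using hne
  have hE := imageEdges_pair ord f h1 h2 h3 h4 hne'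
  have hV : imageVerts f {{a, b, c}, {u, v, w}} ≤ 5 := card_five (imageVerts_pair f a b c u v w) h
  have hV0 : 0 < imageVerts f {{a, b, c}, {u, v, w}} := by
    apply Finset.card_pos.mpr
    refine ⟨f {a, b}, Finset.mem_image_of_mem f ?_⟩
    refine Finset.mem_biUnion.mpr ⟨{a, b, c}, by simp, ?_⟩
    have : a ≠ b := by rintro rfl; omega
    rw [Finset.mem_powersetCard]
    refine ⟨?_, Finset.card_pair this⟩
    intro t ht
    simp only [Finset.mem_insert, Finset.mem_singleton] at ht ⊢
    exact ht.elim Or.inl (fun h => Or.inr (Or.inl h))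
  have hmem : (imageEdges ord f {{a, b, c}, {u, v, w}} : ℝ) /
      (imageVerts f {{a, b, c}, {u, v, w}} : ℝ) ∈ dens H ord f := by
    refine ⟨_, ?_, by simp, rfl⟩
    intro t ht
    simp only [Finset.mem_insert, Finset.mem_singleton] at ht
    rcases ht with rfl | rfl <;> assumption
  have hle := le_csSup (dens_bdd H ord f) hmem
  rw [hE] at hle
  have hV' : (imageVerts f {{a, b, c}, {u, v, w}} : ℝ) ≤ 5 := by exact_mod_cast hV
  have hV0' : (0 : ℝ) < (imageVerts f {{a, b, c}, {u, v, w}} : ℝ) := by exact_mod_cast hV0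
  have : (2 : ℝ) / 5 ≤ ((2 : ℕ) : ℝ) / (imageVerts f {{a, b, c}, {u, v, w}} : ℝ) := by
    push_cast
    gcongr
  linarith

/-- The three possible positions of a pair `a, b` in an edge `{a, b, w}`. -/
theorem edge_cases {H : ThreeGraph} {ord : ℕ → ℕ} {f : Finset ℕ → ℕ}
    {a b w : ℕ} (he : ({a, b, w} : Finset ℕ) ∈ H.edges)
    (hab : ord a < ord b) (hwa : ord a ≠ ord w) (hwb : ord b ≠ ord w) :
    ∃ x y z, ({x, y, z} : Finset ℕ) ∈ H.edges ∧ ord x < ord y ∧ ord y < ord z ∧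
      ((ord b < ord w ∧ f {a, b} = f {x, y}) ∨ (ord w < ord a ∧ f {a, b} = f {y, z}) ∨
        (ord a < ord w ∧ ord w < ord b ∧ f {a, b} = f {x, z})) := by
  rcases lt_or_gt_of_ne hwb with h | h
  · exact ⟨a, b, w, he, hab, h, Or.inl ⟨h, rfl⟩⟩
  · rcases lt_or_gt_of_ne hwa with h' | h'
    · refine ⟨a, w, b, ?_, h', h, Or.inr (Or.inr ⟨h', h, rfl⟩)⟩
      rwa [Finset.pair_comm w b]
    · refine ⟨w, a, b, ?_, h', hab, Or.inr (Or.inl ⟨h', rfl⟩)⟩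
      rwa [Finset.insert_comm w a, Finset.pair_comm w b]

theorem same_of_lt {H : ThreeGraph} {ord : ℕ → ℕ} {f : Finset ℕ → ℕ} {E : Set (ℕ × ℕ × ℕ)}
    (hf : IsPairHom H ord E f) (hq : sSup (dens H ord f) < 2 / 5) {a b w w' : ℕ}
    (he : ({a, b, w} : Finset ℕ) ∈ H.edges) (he' : ({a, b, w'} : Finset ℕ) ∈ H.edges)
    (hab : ord a < ord b) (hwa : ord a ≠ ord w) (hwb : ord b ≠ ord w)
    (hwa' : ord a ≠ ord w') (hwb' : ord b ≠ ord w') :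
    Same (ord a) (ord b) (ord w) (ord w') := by
  obtain ⟨x, y, z, hxyz, h1, h2, h⟩ := edge_cases (f := f) he hab hwa hwb
  obtain ⟨u, v, t, huvt, h3, h4, h'⟩ := edge_cases (f := f) he' hab hwa' hwb'
  have d1 := (hf.2 _ hxyz x y z rfl h1 h2).1
  have d2 := (hf.2 _ huvt u v t rfl h3 h4).1
  have key := triple_eq hq hxyz huvt h1 h2 h3 h4
  clear hq hf he he' hxyz huvt
  generalize f {a, b} = p at *
  generalize f {x, y} = x1 at *
  generalize f {y, z} = x2 at *
  generalize f {x, z} = x3 at *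
  generalize f {u, v} = y1 at *
  generalize f {v, t} = y2 at *
  generalize f {u, t} = y3 at *
  unfold Same
  rcases h with ⟨g, rfl⟩ | ⟨g, rfl⟩ | ⟨g, g1, rfl⟩ <;>
  rcases h' with ⟨k, rfl⟩ | ⟨k, rfl⟩ | ⟨k, k1, rfl⟩
  all_goals
    have key' := key (by simp)
    clear key
  all_goals first
    | (exfalso; clear hwa hwb hwa' hwb' hab g k; tauto)
    | (clear key' d1 d2; omega)

theorem same {H : ThreeGraph} {ord : ℕ → ℕ} {f : Finset ℕ → ℕ} {E : Set (ℕ × ℕ × ℕ)}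
    (hf : IsPairHom H ord E f) (hq : sSup (dens H ord f) < 2 / 5) (a b w w' : ℕ)
    (he : ({a, b, w} : Finset ℕ) ∈ H.edges) (he' : ({a, b, w'} : Finset ℕ) ∈ H.edges)
    (hab : a ≠ b) (hwa : a ≠ w) (hwb : b ≠ w) (hwa' : a ≠ w') (hwb' : b ≠ w') :
    Same (ord a) (ord b) (ord w) (ord w') := by
  have ha : a ∈ (H.verts : Set ℕ) := H.subset_verts _ he (by simp)
  have hb : b ∈ (H.verts : Set ℕ) := H.subset_verts _ he (by simp)
  have hw : w ∈ (H.verts : Set ℕ) := H.subset_verts _ he (by simp)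
  have hw' : w' ∈ (H.verts : Set ℕ) := H.subset_verts _ he' (by simp)
  have n1 := hf.1.ne ha hb hab
  have n2 := hf.1.ne ha hw hwa
  have n3 := hf.1.ne hb hw hwb
  have n4 := hf.1.ne ha hw' hwa'
  have n5 := hf.1.ne hb hw' hwb'
  rcases lt_or_gt_of_ne n1 with h | h
  · exact same_of_lt hf hq he he' h n2 n3 n4 n5
  · rw [Finset.insert_comm] at he he'
    have := same_of_lt hf hq he he' h n3 n2 n5 n4
    unfold Same at *
    omega

theorem lower {ord : ℕ → ℕ} {f : Finset ℕ → ℕ} {E : Set (ℕ × ℕ × ℕ)}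
    (hf : IsPairHom exH ord E f) : 2 / 5 ≤ sSup (dens exH ord f) := by
  by_contra hq
  push Not at hq
  have S := same hf hq
  have I : ∀ i j : ℕ, i < 7 → j < 7 → i ≠ j → ord i ≠ ord j := by
    intro i j hi hj hij
    exact hf.1.ne (by simpa [exH] using hi) (by simpa [exH] using hj) hij
  refine no_order (ord 0) (ord 1) (ord 2) (ord 3) (ord 4) (ord 5) (ord 6)
    ?_ ?_ ?_ ?_ ?_ ?_ ?_ ?_ ?_ ?_ ?_ ?_ ?_ ?_ ?_ ?_ ?_
    (S 0 6 1 5 ?_ ?_ ?_ ?_ ?_ ?_ ?_) (S 0 5 6 3 ?_ ?_ ?_ ?_ ?_ ?_ ?_)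
    (S 5 6 0 2 ?_ ?_ ?_ ?_ ?_ ?_ ?_) (S 5 6 0 4 ?_ ?_ ?_ ?_ ?_ ?_ ?_)
    (S 2 6 5 3 ?_ ?_ ?_ ?_ ?_ ?_ ?_) (S 2 3 6 4 ?_ ?_ ?_ ?_ ?_ ?_ ?_)
    (S 3 4 2 1 ?_ ?_ ?_ ?_ ?_ ?_ ?_)
  all_goals first
    | decide
    | exact I _ _ (by norm_num) (by norm_num) (by norm_num)

/-- The explicit pair homomorphism. -/
def exF (s : Finset ℕ) : ℕ :=
  if s = {0, 3} then 0 else if s = {3, 5} then 1 else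
  if s ∈ ({{0, 6}, {1, 4}, {2, 4}, {2, 6}, {4, 6}} : Finset (Finset ℕ)) then 4 else
  if s ∈ ({{1, 6}, {5, 6}, {3, 4}, {3, 6}} : Finset (Finset ℕ)) then 3 else 2

def exG : Set (ℕ × ℕ × ℕ) := {p | p = (0, 1, 2) ∨ p = (2, 3, 4)}

theorem exF_edge {e : Finset ℕ} (he : e ∈ exEdges) {u v w : ℕ} (h : e = {u, v, w})
    (h1 : u < v) (h2 : v < w) :
    (exF {u, v}, exF {v, w}, exF {u, w}) =
      if e = {0, 3, 5} then (0, 1, 2) else (2, 3, 4) := by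
  simp only [exEdges, Finset.mem_insert, Finset.mem_singleton] at he
  rcases he with rfl | rfl | rfl | rfl | rfl | rfl | rfl | rfl <;>
  · obtain ⟨rfl, rfl, rfl⟩ := sorted_unique id h (by norm_num) (by norm_num) h1 h2
    decide

theorem exHom : IsPairHom exH id exG exF := by
  refine ⟨Function.injective_id.injOn, ?_⟩
  intro e he u v w h h1 h2
  have := exF_edge he h h1 h2
  split_ifs at this <;>
  · rw [this]
    simp only [Prod.mk.injEq] at this
    obtain ⟨a, b, c⟩ := this
    rw [a, b, c]
    simp [exG]

theorem exOriented : Oriented exG := by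
  intro a b c h
  simp only [exG, Set.mem_setOf_eq, Prod.mk.injEq] at h ⊢
  omega

theorem shadow_B : ∀ e ∈ exEdges, e ≠ {0, 3, 5} →
    ({2, 3, 4} : Finset ℕ) ⊆ (e.powersetCard 2).image exF := by decide

theorem shadow_A : ({0, 1, 2} : Finset ℕ) ⊆
    ((({0, 3, 5} : Finset ℕ)).powersetCard 2).image exF := by decide

theorem shadow_sub {E' : Finset (Finset ℕ)} {e : Finset ℕ} (he : e ∈ E') :
    (e.powersetCard 2).image exF ⊆ (shadowOf E').image exF :=
  Finset.image_subset_image (Finset.subset_biUnion_of_mem (fun e => e.powersetCard 2) he)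

theorem upper_one {E' : Finset (Finset ℕ)} (hE : E' ⊆ exEdges) (hne : E'.Nonempty) :
    5 * imageEdges id exF E' ≤ 2 * imageVerts exF E' := by
  have hsub : ∀ p ∈ {p : ℕ × ℕ × ℕ | ∃ e ∈ E', ∃ u v w : ℕ,
      e = ({u, v, w} : Finset ℕ) ∧ id u < id v ∧ id v < id w ∧
      p = (exF {u, v}, exF {v, w}, exF {u, w})},
      ∃ e ∈ E', p = if e = {0, 3, 5} then (0, 1, 2) else (2, 3, 4) := by
    rintro p ⟨e, he, u, v, w, h, h1, h2, rfl⟩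
    exact ⟨e, he, exF_edge (hE he) h h1 h2⟩
  by_cases hA : ({0, 3, 5} : Finset ℕ) ∈ E'
  · by_cases hB : ∃ e ∈ E', e ≠ {0, 3, 5}
    · obtain ⟨e, he, hne'⟩ := hB
      have h1 : imageEdges id exF E' ≤ 2 := by
        refine (Set.ncard_le_ncard (t := {((0 : ℕ), (1 : ℕ), (2 : ℕ)), (2, 3, 4)}) ?_
          (Set.toFinite _)).trans (Set.ncard_pair (by decide)).le
        intro p hp
        obtain ⟨e, -, rfl⟩ := hsub p hp
        split_ifs <;> simp
      have h2 : 5 ≤ imageVerts exF E' := by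
        have : ({0, 1, 2} ∪ {2, 3, 4} : Finset ℕ) ⊆ (shadowOf E').image exF :=
          Finset.union_subset (shadow_A.trans (shadow_sub hA))
            ((shadow_B e (hE he) hne').trans (shadow_sub he))
        exact (show 5 = ({0, 1, 2} ∪ {2, 3, 4} : Finset ℕ).card by decide) ▸
          Finset.card_le_card this
      omega
    · push Not at hB
      have h1 : imageEdges id exF E' ≤ 1 := by
        refine (Set.ncard_le_ncard (t := {((0 : ℕ), (1 : ℕ), (2 : ℕ))}) ?_
          (Set.toFinite _)).trans (Set.ncard_singleton _).le
        intro p hp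
        obtain ⟨e, he, rfl⟩ := hsub p hp
        simp [hB e he]
      have h2 : 3 ≤ imageVerts exF E' :=
        (show 3 = ({0, 1, 2} : Finset ℕ).card by decide) ▸
          Finset.card_le_card (shadow_A.trans (shadow_sub hA))
      omega
  · have hB : ∀ e ∈ E', e ≠ {0, 3, 5} := by
      rintro e he rfl
      exact hA he
    obtain ⟨e, he⟩ := hne
    have h1 : imageEdges id exF E' ≤ 1 := by
      refine (Set.ncard_le_ncard (t := {((2 : ℕ), (3 : ℕ), (4 : ℕ))}) ?_
        (Set.toFinite _)).trans (Set.ncard_singleton _).le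
      intro p hp
      obtain ⟨e, he, rfl⟩ := hsub p hp
      simp [hB e he]
    have h2 : 3 ≤ imageVerts exF E' :=
      (show 3 = ({2, 3, 4} : Finset ℕ).card by decide) ▸
        Finset.card_le_card ((shadow_B e (hE he) (hB e he)).trans (shadow_sub he))
    omega

theorem upper : sSup (dens exH id exF) ≤ 2 / 5 := by
  apply Real.sSup_le _ (by norm_num)
  rintro r ⟨E', hE, hne, rfl⟩
  have h := upper_one hE hne
  have h' : (5 : ℝ) * imageEdges id exF E' ≤ 2 * imageVerts exF E' := by exact_mod_cast h
  apply div_le_of_le_mul₀ (by positivity) (by norm_num)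
  linarith

end MPairAux

open MPairAux in
/-- There is a nonempty 3-graph `H` with `1/3 < m_pair(H) < 1/2`. -/
theorem exists_mpair_strictly_between :
    ∃ H : ThreeGraph, H.edges.Nonempty ∧ 1 / 3 < mpair H ∧ mpair H < 1 / 2 := by
  have hlow : ∀ q ∈ {q : ℝ | ∃ (ord : ℕ → ℕ) (E : Set (ℕ × ℕ × ℕ)) (f : Finset ℕ → ℕ),
      Oriented E ∧ IsPairHom exH ord E f ∧
      q = sSup {r : ℝ | ∃ E' : Finset (Finset ℕ), E' ⊆ exH.edges ∧ E'.Nonempty ∧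
      r = (imageEdges ord f E' : ℝ) / (imageVerts f E' : ℝ)}}, 2 / 5 ≤ q := by
    rintro q ⟨ord, E, f, -, hf, rfl⟩
    exact lower hf
  refine ⟨exH, ⟨{0, 1, 6}, by decide⟩, ?_, ?_⟩
  · have : 2 / 5 ≤ mpair exH := le_csInf ⟨_, id, exG, exF, exOriented, exHom, rfl⟩ hlow
    linarith
  · have : mpair exH ≤ sSup (dens exH id exF) :=
      csInf_le ⟨2 / 5, hlow⟩ ⟨id, exG, exF, exOriented, exHom, rfl⟩
    linarith [upper]
end
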